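/- arXiv:1512.06690 — 10 statements merged into one kernel-verified Lean document; each statement's English description precedes it below -/
import Mathlib

section
/- Let A be an ℓA-quasi-cyclic code of length nA = ℓA·mA over F_q with generator matrix G^A(X) = (g^A_{h,h'}(X)) ∈ F_q[X]^{ℓA×ℓA} in RGB/POT form, and let B be an ℓB-quasi-cyclic code of length nB = ℓB·mB over F_q with generator matrix G^B(X) = (g^B_{g,g'}(X)) ∈ F_q[X]^{ℓB×ℓB} in RGB/POT form. Assume gcd(nA,nB) = 1 and fix integers a, b with a·nA + b·nB = 1; set ℓ = ℓA·ℓB and m = mA·mB. Then the set {c(M) : M ∈ A⊗B} of serialized polynomial-vector representations of the product code is exactly the F_q[X]/(X^m−1)-submodule of (F_q[X]/(X^m−1))^ℓ generated by the ℓ rows of the matrix U^0(X) whose entry in row g+h·ℓB and column g'+h'·ℓB (for g,g' ∈ [0,ℓB), h,h' ∈ [0,ℓA)) equals g^A_{h,h'}(X^{b·nB}) · g^B_{g,g'}(X^{a·nA}) · X^{s(g',h')}, computed in F_q[X]/(X^m−1) with the substitution convention. -/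
open Polynomial

noncomputable section

/-- The quotient ring `F[X]/(X^m - 1)`. -/
abbrev QR (F : Type*) [Field F] (m : ℕ) : Type _ := AdjoinRoot (X ^ m - 1 : F[X])

/-- Canonical projection `F[X] → F[X]/(X^m - 1)`. -/
def qmk (F : Type*) [Field F] (m : ℕ) : F[X] →+* QR F m := AdjoinRoot.mk (X ^ m - 1 : F[X])

/-- The residue `X^t` for an integer `t`, i.e. `X^(t mod m)` in `F[X]/(X^m-1)`. -/
def zX (F : Type*) [Field F] (m : ℕ) (t : ℤ) : QR F m := qmk F m (X ^ (t % (m : ℤ)).toNat)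

/-- Substitution convention: `f(X^t)` as an element of `F[X]/(X^m-1)`. -/
def substX (F : Type*) [Field F] (m : ℕ) (t : ℤ) (f : F[X]) : QR F m :=
  Polynomial.aeval (zX F m t) f

lemma idx_lt {ℓ m : ℕ} (i : Fin m) (j : Fin ℓ) : (i : ℕ) * ℓ + (j : ℕ) < ℓ * m := by
  calc (i : ℕ) * ℓ + (j : ℕ) < (i : ℕ) * ℓ + ℓ := by omega
    _ = ((i : ℕ) + 1) * ℓ := by ring
    _ ≤ m * ℓ := Nat.mul_le_mul_right ℓ i.isLt
    _ = ℓ * m := Nat.mul_comm m ℓ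

/-- Polynomial-vector representation of a codeword of an `ℓ`-quasi-cyclic code:
`c_j(X) = ∑_{i<m} c_{iℓ+j} X^i`. -/
def polyRep {F : Type*} [Semiring F] (ℓ m : ℕ) (c : Fin (ℓ * m) → F) : Fin ℓ → F[X] :=
  fun j => ∑ i : Fin m, Polynomial.monomial (i : ℕ) (c ⟨(i : ℕ) * ℓ + (j : ℕ), idx_lt i j⟩)

/-- A set of words of length `n` is `ℓ`-quasi-cyclic if it is closed under cyclic shift by `ℓ`. -/
def IsQuasiCyclic {F : Type*} {n : ℕ} (ℓ : ℕ) (C : Set (Fin n → F)) : Prop :=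
  ∀ c ∈ C, (fun k : Fin n => c ⟨((k : ℕ) + ℓ) % n, Nat.mod_lt _ k.pos⟩) ∈ C

/-- The set of polynomial-vector representations (mod `X^m-1`) of codewords of `C`. -/
def codePolySet (F : Type*) [Field F] (ℓ m : ℕ) (C : Submodule F (Fin (ℓ * m) → F)) :
    Set (Fin ℓ → QR F m) :=
  { v | ∃ c ∈ C, v = fun j => qmk F m (polyRep ℓ m c j) }

/-- `G` is a generator matrix in RGB/POT form of the `ℓ`-quasi-cyclic code `C` of length `ℓm`. -/
def IsRGBPOT (F : Type*) [Field F] (ℓ m : ℕ) (C : Submodule F (Fin (ℓ * m) → F))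
    (G : Matrix (Fin ℓ) (Fin ℓ) F[X]) : Prop :=
  (∀ i j : Fin ℓ, j < i → G i j = 0) ∧
  (∀ i j : Fin ℓ, j < i → (G j i).degree < (G i i).degree) ∧
  (∀ i : Fin ℓ, G i i ∣ (X ^ m - 1)) ∧
  (∀ i : Fin ℓ, G i i = X ^ m - 1 → ∀ j : Fin ℓ, i < j → G i j = 0) ∧
  codePolySet F ℓ m C =
    ↑(Submodule.span (QR F m) (Set.range fun i => fun j => qmk F m (G i j)))

/-- `M` is a codeword (an `nB × nA` array) of the product code `A ⊗ B`. -/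
def IsProductCW {F : Type*} {nA nB : ℕ} (A : Set (Fin nA → F)) (B : Set (Fin nB → F))
    (M : Fin nB → Fin nA → F) : Prop :=
  (∀ i, M i ∈ A) ∧ (∀ j, (fun i => M i j) ∈ B)

/-- The linear map sending a vector `c` of length `n` to the polynomial `∑ c_i X^i`. -/
def vecPolyL (F : Type*) [CommSemiring F] (n : ℕ) : (Fin n → F) →ₗ[F] F[X] :=
  ∑ i : Fin n, (Polynomial.monomial (i : ℕ)).comp (LinearMap.proj i)

/-- The cyclic code of length `n` with generator polynomial `g`. -/
def cyclicCodeOf (F : Type*) [Field F] (n : ℕ) (g : F[X]) : Submodule F (Fin n → F) :=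
  Submodule.comap (vecPolyL F n) (Submodule.restrictScalars F (Ideal.span {g}))

/-- Serialized polynomial-vector representation of a product-code codeword
(components indexed by pairs `(g, h)` standing for `g + h⬝ℓB`). -/
def ser (F : Type*) [Field F] (ℓA mA ℓB mB : ℕ) (a b : ℤ)
    (M : Fin (ℓB * mB) → Fin (ℓA * mA) → F) : Fin ℓB × Fin ℓA → QR F (mA * mB) :=
  fun p =>
    zX F (mA * mB) (-(p.1 : ℤ) * b * mB - (p.2 : ℤ) * a * mA) *
      ∑ i : Fin mB, ∑ j : Fin mA,
        algebraMap F (QR F (mA * mB))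
            (M ⟨(i : ℕ) * ℓB + (p.1 : ℕ), idx_lt i p.1⟩
               ⟨(j : ℕ) * ℓA + (p.2 : ℕ), idx_lt j p.2⟩) *
          zX F (mA * mB) ((i : ℤ) * (a * (ℓA * mA)) + (j : ℤ) * (b * (ℓB * mB)))

/-- Serialized polynomial-vector representation in the case `ℓB = 1` (column code cyclic). -/
def ser1 (F : Type*) [Field F] (ℓ mA mB : ℕ) (a b : ℤ)
    (M : Fin mB → Fin (ℓ * mA) → F) : Fin ℓ → QR F (mA * mB) :=
  fun h =>
    zX F (mA * mB) (-(h : ℤ) * a * mA) *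
      ∑ i : Fin mB, ∑ j : Fin mA,
        algebraMap F (QR F (mA * mB)) (M i ⟨(j : ℕ) * ℓ + (h : ℕ), idx_lt j h⟩) *
          zX F (mA * mB) ((i : ℤ) * (a * (ℓ * mA)) + (j : ℤ) * (b * mB))

end

noncomputable section
open Polynomial
/-- `g` is the monic greatest common divisor of `p` and `q`. -/
def IsMonicGcd {F : Type*} [Field F] (p q g : F[X]) : Prop :=
  g.Monic ∧ g ∣ p ∧ g ∣ q ∧ ∀ d : F[X], d ∣ p → d ∣ q → d ∣ g
end

noncomputable section
/-- The element of `Fin n` given by an integer `t` reduced mod `n`. -/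
def intModFin (n : ℕ) (hn : 0 < n) (t : ℤ) : Fin n :=
  ⟨(t % (n : ℤ)).toNat, by
    have h1 : 0 ≤ t % (n : ℤ) := Int.emod_nonneg t (by exact_mod_cast hn.ne')
    have h2 : t % (n : ℤ) < (n : ℤ) := Int.emod_lt_of_pos t (by exact_mod_cast hn)
    omega⟩

/-- Integer reduced mod `m`, as a natural number. -/
def natMod (m : ℕ) (t : ℤ) : ℕ := (t % (m : ℤ)).toNat
end

noncomputable section

/-- The residue class of `X` in `F[X]/(X^m - 1)`, as a unit. -/
def rootUnit (F : Type*) [Field F] {m : ℕ} (hm : 0 < m) : (QR F m)ˣ :=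
  Units.ofPowEqOne (AdjoinRoot.root (X ^ m - 1 : F[X])) m
    (by
      have h := AdjoinRoot.eval₂_root (X ^ m - 1 : F[X])
      rwa [eval₂_sub, eval₂_X_pow, eval₂_one, sub_eq_zero] at h) hm.ne'

lemma rootUnit_pow_eq_one (F : Type*) [Field F] {m : ℕ} (hm : 0 < m) :
    rootUnit F hm ^ m = 1 :=
  Units.pow_ofPowEqOne _ _

lemma zX_eq_rootUnit_zpow (F : Type*) [Field F] {m : ℕ} (hm : 0 < m) (t : ℤ) :
    zX F m t = ((rootUnit F hm ^ t : (QR F m)ˣ) : QR F m) := by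
  have h0 : 0 ≤ t % (m : ℤ) := Int.emod_nonneg t (by exact_mod_cast hm.ne')
  have h1 : rootUnit F hm ^ t = rootUnit F hm ^ (t % (m : ℤ)).toNat := by
    conv_lhs => rw [← Int.emod_add_mul_ediv t m, zpow_add, zpow_mul]
    rw [zpow_natCast (rootUnit F hm) m, rootUnit_pow_eq_one, one_zpow, mul_one, ← zpow_natCast,
      Int.toNat_of_nonneg h0]
  rw [h1]
  simp [zX, qmk, rootUnit]

lemma zX_add (F : Type*) [Field F] {m : ℕ} (hm : 0 < m) (s t : ℤ) :
    zX F m (s + t) = zX F m s * zX F m t := by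
  simp only [zX_eq_rootUnit_zpow F hm, zpow_add, Units.val_mul]

lemma zX_pow (F : Type*) [Field F] {m : ℕ} (hm : 0 < m) (t : ℤ) (k : ℕ) :
    zX F m t ^ k = zX F m (k * t) := by
  simp only [zX_eq_rootUnit_zpow F hm, mul_comm (k : ℤ) t, zpow_mul, zpow_natCast,
    Units.val_pow_eq_pow_val]

lemma zX_eq_one_of_dvd (F : Type*) [Field F] {m : ℕ} {t : ℤ} (h : (m : ℤ) ∣ t) :
    zX F m t = 1 := by
  simp [zX, Int.emod_eq_zero_of_dvd h]

lemma zX_one (F : Type*) [Field F] {m : ℕ} (hm : 0 < m) :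
    zX F m 1 = AdjoinRoot.root (X ^ m - 1 : F[X]) := by
  simp [zX_eq_rootUnit_zpow F hm, rootUnit]

/-- The substitution `X ↦ X^t` as a homomorphism `F[X]/(X^n - 1) → F[X]/(X^m - 1)`. -/
def substHom (F : Type*) [Field F] {m n : ℕ} (hm : 0 < m) {t : ℤ} (h : (m : ℤ) ∣ n * t) :
    QR F n →ₐ[F] QR F m :=
  AdjoinRoot.liftAlgHom (X ^ n - 1 : F[X]) (Algebra.ofId F (QR F m)) (zX F m t) (by
    simp [zX_pow F hm, zX_eq_one_of_dvd F h])

lemma substHom_qmk (F : Type*) [Field F] {m n : ℕ} (hm : 0 < m) {t : ℤ}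
    (h : (m : ℤ) ∣ n * t) (f : F[X]) :
    substHom F hm h (qmk F n f) = substX F m t f :=
  AdjoinRoot.liftAlgHom_mk _ _ _ _ f

lemma substHom_root (F : Type*) [Field F] {m n : ℕ} (hm : 0 < m) {t : ℤ}
    (h : (m : ℤ) ∣ n * t) :
    substHom F hm h (AdjoinRoot.root (X ^ n - 1 : F[X])) = zX F m t :=
  AdjoinRoot.liftAlgHom_root _ _ _ _

lemma span_range_root_pow (F : Type*) [Field F] (f : F[X]) :
    Submodule.span F (Set.range fun k : ℕ => AdjoinRoot.root f ^ k) = ⊤ := by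
  refine eq_top_iff.2 fun x _ => ?_
  obtain ⟨p, rfl⟩ := AdjoinRoot.mk_surjective x
  rw [← AdjoinRoot.aeval_eq, aeval_eq_sum_range]
  exact Submodule.sum_mem _ fun k _ =>
    Submodule.smul_mem _ _ (Submodule.subset_span ⟨k, rfl⟩)

/-- The outer product of two vectors, pushed into a common ring and scaled entrywise by `z`. -/
def twistedOuter {R S T ι κ : Type*} [CommRing R] [CommRing S] [CommRing T]
    (φ : R →+* T) (ψ : S →+* T) (z : κ × ι → T) (v : ι → R) (w : κ → S) : κ × ι → T :=
  fun p => φ (v p.2) * ψ (w p.1) * z p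

lemma twistedOuter_mem_span {R S T ι κ : Type*} [CommRing R] [CommRing S] [CommRing T]
    (φ : R →+* T) (ψ : S →+* T) (z : κ × ι → T) {α β : Type*} (G : α → ι → R) (H : β → κ → S)
    {v : ι → R} {w : κ → S} (hv : v ∈ Submodule.span R (Set.range G))
    (hw : w ∈ Submodule.span S (Set.range H)) :
    twistedOuter φ ψ z v w ∈ Submodule.span T
      (Set.range fun q : β × α => twistedOuter φ ψ z (G q.2) (H q.1)) := by
  induction hv using Submodule.span_induction with
  | mem v hv =>
    obtain ⟨i, rfl⟩ := hv
    induction hw using Submodule.span_induction with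
    | mem w hw =>
      obtain ⟨j, rfl⟩ := hw
      exact Submodule.subset_span ⟨(j, i), rfl⟩
    | zero =>
      convert Submodule.zero_mem _
      ext p
      simp [twistedOuter]
    | add x y _ _ hx hy =>
      convert Submodule.add_mem _ hx hy using 1
      ext p
      simp [twistedOuter, mul_add, add_mul]
    | smul r x _ hx =>
      convert Submodule.smul_mem _ (ψ r) hx using 1
      ext p
      simp only [twistedOuter, Pi.smul_apply, smul_eq_mul, map_mul]
      ring
  | zero =>
    convert Submodule.zero_mem _
    ext p
    simp [twistedOuter]
  | add x y _ _ hx hy =>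
    convert Submodule.add_mem _ hx hy using 1
    ext p
    simp [twistedOuter, add_mul]
  | smul r x _ hx =>
    convert Submodule.smul_mem _ (φ r) hx using 1
    ext p
    simp only [twistedOuter, Pi.smul_apply, smul_eq_mul, map_mul]
    ring

/-- Serialization as a linear map. -/
def serL (F : Type*) [Field F] (ℓA mA ℓB mB : ℕ) (a b : ℤ) :
    (Fin (ℓB * mB) → Fin (ℓA * mA) → F) →ₗ[F] (Fin ℓB × Fin ℓA → QR F (mA * mB)) where
  toFun := ser F ℓA mA ℓB mB a b
  map_add' M N := by
    ext p
    simp only [ser, Pi.add_apply, map_add, add_mul, Finset.sum_add_distrib, mul_add]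
  map_smul' c M := by
    ext p
    simp only [ser, Pi.smul_apply, smul_eq_mul, map_mul, RingHom.id_apply, Algebra.smul_def,
      Finset.mul_sum]
    exact Finset.sum_congr rfl fun i _ => Finset.sum_congr rfl fun j _ => by ring

lemma serL_apply (F : Type*) [Field F] (ℓA mA ℓB mB : ℕ) (a b : ℤ)
    (M : Fin (ℓB * mB) → Fin (ℓA * mA) → F) :
    serL F ℓA mA ℓB mB a b M = ser F ℓA mA ℓB mB a b M :=
  rfl

/-- The product code as a linear subspace of the space of arrays. -/
def productCode {F : Type*} [Field F] {nA nB : ℕ} (A : Submodule F (Fin nA → F))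
    (B : Submodule F (Fin nB → F)) : Submodule F (Fin nB → Fin nA → F) where
  carrier := { M | IsProductCW (A : Set _) (B : Set _) M }
  zero_mem' := ⟨fun _ => A.zero_mem, fun _ => B.zero_mem⟩
  add_mem' hM hN :=
    ⟨fun i => A.add_mem (hM.1 i) (hN.1 i), fun j => B.add_mem (hM.2 j) (hN.2 j)⟩
  smul_mem' c _ hM := ⟨fun i => A.smul_mem c (hM.1 i), fun j => B.smul_mem c (hM.2 j)⟩

lemma outer_mem_productCode {F : Type*} [Field F] {nA nB : ℕ} {A : Submodule F (Fin nA → F)}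
    {B : Submodule F (Fin nB → F)} {x : Fin nA → F} {y : Fin nB → F} (hx : x ∈ A)
    (hy : y ∈ B) : (fun i j => y i * x j) ∈ productCode A B := by
  refine ⟨fun i => A.smul_mem (y i) hx, fun j => ?_⟩
  simpa only [mul_comm, Pi.smul_def, smul_eq_mul, SetLike.mem_coe] using B.smul_mem (x j) hy

lemma exists_eq_sum_outer {F : Type*} [Field F] {nA nB : ℕ} {A : Submodule F (Fin nA → F)}
    {B : Submodule F (Fin nB → F)} {M : Fin nB → Fin nA → F}
    (hM : IsProductCW (A : Set _) (B : Set _) M) :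
    ∃ x : Fin nA → Fin nA → F, ∃ y : Fin nA → Fin nB → F,
      (∀ k, x k ∈ A) ∧ (∀ k, y k ∈ B) ∧ M = ∑ k, fun i j => y k i * x k j := by
  obtain ⟨P, hP⟩ := A.exists_isCompl
  let π := A.projectionOnto P hP
  refine ⟨fun k => π (Pi.single k 1), fun k i => M i k, fun k => (π _).2, hM.2, ?_⟩
  funext i j
  have h : ((π (M i) : A) : Fin nA → F) = M i :=
    congrArg Subtype.val (Submodule.projectionOnto_apply_left hP ⟨M i, hM.1 i⟩)
  conv_lhs => rw [← h, pi_eq_sum_univ' (M i)]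
  simp [Finset.sum_apply]

lemma ser_outer (F : Type*) [Field F] {ℓA mA ℓB mB : ℕ} (hm : 0 < mA * mB) (a b : ℤ)
    (x : Fin (ℓA * mA) → F) (y : Fin (ℓB * mB) → F) (p : Fin ℓB × Fin ℓA) :
    ser F ℓA mA ℓB mB a b (fun i j => y i * x j) p =
      substX F (mA * mB) (b * (ℓB * mB)) (polyRep ℓA mA x p.2) *
        substX F (mA * mB) (a * (ℓA * mA)) (polyRep ℓB mB y p.1) *
          zX F (mA * mB) (-(p.1 : ℤ) * b * mB - (p.2 : ℤ) * a * mA) := by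
  simp only [ser, substX, polyRep, map_sum, aeval_monomial, zX_pow F hm, map_mul, zX_add F hm]
  rw [mul_comm (zX F _ _)]
  congr 1
  rw [mul_comm (∑ j : Fin mA, _), Finset.sum_mul_sum]
  exact Finset.sum_congr rfl fun i _ => Finset.sum_congr rfl fun j _ => by ring

end

theorem unreduced_basis_of_quasi_cyclic_product_code
    (F : Type*) [Field F] [Fintype F]
    (ℓA mA ℓB mB : ℕ) (hℓA : 0 < ℓA) (hmA : 0 < mA) (hℓB : 0 < ℓB) (hmB : 0 < mB)
    (A : Submodule F (Fin (ℓA * mA) → F)) (B : Submodule F (Fin (ℓB * mB) → F))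
    (hAqc : IsQuasiCyclic ℓA (A : Set (Fin (ℓA * mA) → F)))
    (hBqc : IsQuasiCyclic ℓB (B : Set (Fin (ℓB * mB) → F)))
    (GA : Matrix (Fin ℓA) (Fin ℓA) F[X]) (GB : Matrix (Fin ℓB) (Fin ℓB) F[X])
    (hGA : IsRGBPOT F ℓA mA A GA) (hGB : IsRGBPOT F ℓB mB B GB)
    (hcop : Nat.Coprime (ℓA * mA) (ℓB * mB))
    (a b : ℤ) (hab : a * (ℓA * mA) + b * (ℓB * mB) = 1) :
    { v : Fin ℓB × Fin ℓA → QR F (mA * mB) |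
        ∃ M : Fin (ℓB * mB) → Fin (ℓA * mA) → F,
          IsProductCW (A : Set _) (B : Set _) M ∧ v = ser F ℓA mA ℓB mB a b M }
      = ↑(Submodule.span (QR F (mA * mB))
          (Set.range fun p : Fin ℓB × Fin ℓA => fun p' : Fin ℓB × Fin ℓA =>
            substX F (mA * mB) (b * (ℓB * mB)) (GA p.2 p'.2) *
              substX F (mA * mB) (a * (ℓA * mA)) (GB p.1 p'.1) *
                zX F (mA * mB) (-(p'.1 : ℤ) * b * mB - (p'.2 : ℤ) * a * mA))) := by
  have hm : 0 < mA * mB := Nat.mul_pos hmA hmB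
  have hdA : ((mA * mB : ℕ) : ℤ) ∣ mA * (b * (ℓB * mB)) := ⟨b * ℓB, by push_cast; ring⟩
  have hdB : ((mA * mB : ℕ) : ℤ) ∣ mB * (a * (ℓA * mA)) := ⟨a * ℓA, by push_cast; ring⟩
  let z : Fin ℓB × Fin ℓA → QR F (mA * mB) := fun p =>
    zX F (mA * mB) (-(p.1 : ℤ) * b * mB - (p.2 : ℤ) * a * mA)
  let E := twistedOuter (substHom F hm hdA).toRingHom (substHom F hm hdB).toRingHom z
  let rA : Fin ℓA → Fin ℓA → QR F mA := fun i j => qmk F mA (GA i j)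
  let rB : Fin ℓB → Fin ℓB → QR F mB := fun i j => qmk F mB (GB i j)
  have hA : codePolySet F ℓA mA A = ↑(Submodule.span (QR F mA) (Set.range rA)) :=
    hGA.2.2.2.2
  have hB : codePolySet F ℓB mB B = ↑(Submodule.span (QR F mB) (Set.range rB)) :=
    hGB.2.2.2.2
  have hser : ∀ x y, ser F ℓA mA ℓB mB a b (fun i j => y i * x j) =
      E (fun j => qmk F mA (polyRep ℓA mA x j)) (fun j => qmk F mB (polyRep ℓB mB y j)) := by
    intro x y
    funext p
    rw [ser_outer F hm]
    simp only [← substHom_qmk F hm hdA, ← substHom_qmk F hm hdB]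
    rfl
  have hrow : (fun p p' : Fin ℓB × Fin ℓA =>
      substX F (mA * mB) (b * (ℓB * mB)) (GA p.2 p'.2) *
        substX F (mA * mB) (a * (ℓA * mA)) (GB p.1 p'.1) *
          zX F (mA * mB) (-(p'.1 : ℤ) * b * mB - (p'.2 : ℤ) * a * mA)) =
      fun p => E (rA p.2) (rB p.1) := by
    funext p p'
    simp only [← substHom_qmk F hm hdA, ← substHom_qmk F hm hdB]
    rfl
  rw [hrow]
  apply Set.Subset.antisymm
  · rintro _ ⟨M, hM, rfl⟩
    obtain ⟨x, y, hx, hy, rfl⟩ := exists_eq_sum_outer hM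
    rw [← serL_apply, map_sum]
    refine Submodule.sum_mem _ fun k _ => ?_
    rw [serL_apply, hser]
    exact twistedOuter_mem_span _ _ z rA rB (hA.subset ⟨x k, hx k, rfl⟩)
      (hB.subset ⟨y k, hy k, rfl⟩)
  · suffices h : (Submodule.span (QR F (mA * mB))
        (Set.range fun p : Fin ℓB × Fin ℓA => E (rA p.2) (rB p.1))).restrictScalars F ≤
          (productCode A B).map (serL F ℓA mA ℓB mB a b) by
      intro v hv
      obtain ⟨M, hM, rfl⟩ := h hv
      exact ⟨M, hM, rfl⟩
    rw [← Submodule.span_smul_of_span_eq_top (span_range_root_pow F (X ^ (mA * mB) - 1)),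
      Submodule.span_le]
    rintro _ ⟨_, ⟨k, rfl⟩, _, ⟨p, rfl⟩, rfl⟩
    obtain ⟨x, hx, hxv⟩ := hA.superset (Submodule.smul_mem _
      (AdjoinRoot.root (X ^ mA - 1 : F[X]) ^ k) (Submodule.subset_span ⟨p.2, rfl⟩))
    obtain ⟨y, hy, hyv⟩ := hB.superset (Submodule.smul_mem _
      (AdjoinRoot.root (X ^ mB - 1 : F[X]) ^ k) (Submodule.subset_span ⟨p.1, rfl⟩))
    refine ⟨_, outer_mem_productCode hx hy, ?_⟩
    rw [serL_apply, hser, ← hxv, ← hyv]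
    have hroot : AdjoinRoot.root (X ^ (mA * mB) - 1 : F[X]) =
        zX F (mA * mB) (b * (ℓB * mB)) * zX F (mA * mB) (a * (ℓA * mA)) := by
      rw [← zX_add F hm, add_comm, hab, zX_one F hm]
    funext q
    simp only [E, twistedOuter, Pi.smul_apply, smul_eq_mul, map_mul, map_pow,
      AlgHom.toRingHom_eq_coe, RingHom.coe_coe, substHom_root, hroot]
    ring
end

section
/- (Generalized Semenov–Trifonov bound.) Let A be an ℓ-quasi-cyclic code over F_q of length ℓ·mA with minimum Hamming distance dA and generator matrix G^A(X) in RGB/POT form, and let B be a cyclic code over F_q of length mB with generator polynomial g^B and minimum Hamming distance dB; assume gcd(mA,mB) = 1. Let α ∈ F_{q^{sA}} have multiplicative order mA and β ∈ F_{q^{sB}} have multiplicative order mB, with both lying in a common extension F_{q^s}. Let integers f1, f2 ≥ 0, z1, z2 > 0, δ > 2 satisfy gcd(z1,mA) = 1 and gcd(z2,mB) = 1. Let D = { (f1 + i·z1) mod mA : i ∈ [0, δ−2], g^B(β^{f2+i·z2}) ≠ 0 }, let E = ∩_{j ∈ D} { v ∈ F_{q^s}^ℓ : G^A(α^j)·v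 = 0 }, and let d^ec be the minimum distance of the eigencode C(E). Assume that for every codeword a ∈ A (with polynomial-vector representation (a_0(X),…,a_{ℓ−1}(X))), every b ∈ B (as a polynomial b(X) of degree < mB), every v ∈ E, and every i ∈ [0, δ−2]: (Σ_{j=0}^{ℓ−1} a_j(α^{f1+i·z1})·v_j) · b(β^{f2+i·z2}) = 0. Then dA ≥ ⌈min(δ, d^ec)/dB⌉ (where min(δ, d^ec) = δ if C(E) = {0}). -/
open Polynomial

/-- A vanishing power-sum criterion: if the nodes `x s` are distinct on `S` and the first `n ≥ #S`
weighted power sums vanish, then all weights vanish. -/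
theorem eq_zero_of_forall_sum_mul_pow_eq_zero {ι K : Type*} [Field K] (S : Finset ι) (x c : ι → K)
    (hx : Set.InjOn x S) (n : ℕ) (hn : S.card ≤ n)
    (h : ∀ i < n, ∑ s ∈ S, c s * x s ^ i = 0) {s : ι} (hs : s ∈ S) : c s = 0 := by
  classical
  have hpoly : ∀ p : K[X], p.natDegree < n → ∑ t ∈ S, c t * p.eval (x t) = 0 := by
    intro p hp
    simp_rw [Polynomial.eval_eq_sum_range' hp, Finset.mul_sum]
    rw [Finset.sum_comm]
    refine Finset.sum_eq_zero fun i hi => ?_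
    simp_rw [mul_left_comm (c _)]
    rw [← Finset.mul_sum, h i (Finset.mem_range.mp hi), mul_zero]
  have hcard := Finset.card_pos.mpr ⟨s, hs⟩
  have key := hpoly (∏ t ∈ S.erase s, (X - C (x t))) <| by
    rw [Polynomial.natDegree_finsetProd_X_sub_C_eq_card, Finset.card_erase_of_mem hs]
    omega
  simp only [Polynomial.eval_prod, Polynomial.eval_sub, Polynomial.eval_X,
    Polynomial.eval_C] at key
  rw [Finset.sum_eq_single_of_mem s hs] at key
  · refine (mul_eq_zero.mp key).resolve_right (Finset.prod_ne_zero_iff.mpr fun t ht => ?_)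
    rw [Finset.mem_erase] at ht
    exact sub_ne_zero.mpr fun e => ht.1 (hx ht.2 hs e.symm)
  · intro t ht hts
    rw [Finset.prod_eq_zero (Finset.mem_erase.mpr ⟨hts, ht⟩) (sub_self _), mul_zero]

/-- Products of powers of elements of coprime orders are pairwise distinct. -/
theorem pow_mul_pow_injective_of_coprime_orderOf {K : Type*} [Field K] {m n : ℕ}
    {α β : K} (hm : 0 < m) (hn : 0 < n) (hα : orderOf α = m) (hβ : orderOf β = n)
    (hmn : m.Coprime n) {y z : ℕ} (hy : y.Coprime m) (hz : z.Coprime n) :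
    Function.Injective fun p : Fin m × Fin n => (α ^ y) ^ (p.1 : ℕ) * (β ^ z) ^ (p.2 : ℕ) := by
  have cancel : ∀ {γ ε : K} {u v w i i' j j' : ℕ}, 0 < u → orderOf γ = u → orderOf ε = v →
      u.Coprime v → w.Coprime u → i < u → i' < u →
      (γ ^ w) ^ i * ε ^ j = (γ ^ w) ^ i' * ε ^ j' → i = i' := by
    intro γ ε u v w i i' j j' hu hγ hε huv hw hi hi' e
    have e' := congrArg (· ^ v) e
    have hεv : ε ^ v = 1 := hε ▸ pow_orderOf_eq_one ε
    simp only [mul_pow, pow_right_comm ε _ v, hεv, one_pow, mul_one] at e'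
    simp only [← pow_mul, mul_assoc] at e'
    have hγ0 : IsOfFinOrder γ := orderOf_pos_iff.mp (hγ.symm ▸ hu)
    have hmod := (hγ0.pow_eq_pow_iff_modEq).mp e'
    rw [hγ] at hmod
    exact ((hmod.cancel_left_of_coprime hw.symm).cancel_right_of_coprime huv).eq_of_lt_of_lt hi hi'
  rintro ⟨i, j⟩ ⟨i', j'⟩ e
  have e₁ : (α ^ y) ^ (i : ℕ) * (β ^ z) ^ (j : ℕ) = (α ^ y) ^ (i' : ℕ) * (β ^ z) ^ (j' : ℕ) := e
  refine Prod.ext (Fin.ext ?_) (Fin.ext ?_)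
  · rw [← pow_mul β, ← pow_mul β] at e₁
    exact cancel hm hα hβ hmn hy i.isLt i'.isLt e₁
  · rw [← pow_mul α, ← pow_mul α, mul_comm, mul_comm (α ^ _)] at e₁
    exact cancel hn hβ hα hmn.symm hz j.isLt j'.isLt e₁

theorem aeval_polyRep {F K : Type*} [Field F] [Field K] [Algebra F K] (ℓ m : ℕ)
    (c : Fin (ℓ * m) → F) (j : Fin ℓ) (x : K) :
    aeval x (polyRep ℓ m c j) =
      ∑ i : Fin m, algebraMap F K (c ⟨(i : ℕ) * ℓ + (j : ℕ), idx_lt i j⟩) * x ^ (i : ℕ) := by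
  simp [polyRep, map_sum, aeval_monomial]

theorem vecPolyL_apply {F : Type*} [CommSemiring F] (n : ℕ) (c : Fin n → F) :
    vecPolyL F n c = ∑ i : Fin n, monomial (i : ℕ) (c i) := by
  simp [vecPolyL]

theorem aeval_vecPolyL {F K : Type*} [Field F] [Field K] [Algebra F K] (n : ℕ)
    (c : Fin n → F) (x : K) :
    aeval x (vecPolyL F n c) = ∑ i : Fin n, algebraMap F K (c i) * x ^ (i : ℕ) := by
  simp [vecPolyL_apply, map_sum, aeval_monomial]

theorem degree_vecPolyL_lt {F : Type*} [Field F] {n : ℕ} (c : Fin n → F) :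
    (vecPolyL F n c).degree < (n : WithBot ℕ) := by
  rw [vecPolyL_apply, ← Polynomial.mem_degreeLT]
  exact Submodule.sum_mem _ fun i _ => Polynomial.mem_degreeLT.mpr <|
    (degree_monomial_le _ _).trans_lt (by exact_mod_cast i.isLt)

/-- The Hamming weight of a block of a word is at most the weight of the word. -/
theorem hammingNorm_block_le {F : Type*} [Field F] [DecidableEq F] {ℓ m : ℕ}
    (a : Fin (ℓ * m) → F) (k : Fin m) :
    hammingNorm (fun j : Fin ℓ => a ⟨(k : ℕ) * ℓ + (j : ℕ), idx_lt k j⟩) ≤ hammingNorm a := by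
  refine Finset.card_le_card_of_injOn (fun j : Fin ℓ => ⟨(k : ℕ) * ℓ + (j : ℕ), idx_lt k j⟩)
    (fun j hj => by simpa using hj) fun i _ j _ hij => ?_
  simpa [Fin.ext_iff] using hij

/-- The number of nonzero blocks of a word is at most its Hamming weight. -/
theorem card_nonzero_blocks_le {F : Type*} [Field F] [DecidableEq F] {ℓ m : ℕ}
    (a : Fin (ℓ * m) → F) :
    (Finset.univ.filter fun k : Fin m =>
      (fun j : Fin ℓ => a ⟨(k : ℕ) * ℓ + (j : ℕ), idx_lt k j⟩) ≠ 0).card ≤ hammingNorm a := by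
  refine Finset.card_le_card_of_surjOn
    (fun n : Fin (ℓ * m) => ⟨(n : ℕ) / ℓ, Nat.div_lt_of_lt_mul n.isLt⟩) fun k hk => ?_
  obtain ⟨j, hj⟩ := Function.ne_iff.mp (Finset.mem_filter.mp hk).2
  refine ⟨⟨(k : ℕ) * ℓ + (j : ℕ), idx_lt k j⟩, by simpa using hj, Fin.ext ?_⟩
  change ((k : ℕ) * ℓ + j) / ℓ = k
  rw [mul_comm, Nat.mul_add_div j.pos, Nat.div_eq_of_lt j.isLt, add_zero]

theorem exists_block_ne_zero {F : Type*} [Field F] {ℓ m : ℕ} {a : Fin (ℓ * m) → F}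
    (ha : a ≠ 0) :
    ∃ k : Fin m, (fun j : Fin ℓ => a ⟨(k : ℕ) * ℓ + (j : ℕ), idx_lt k j⟩) ≠ 0 := by
  obtain ⟨n, hn⟩ := Function.ne_iff.mp ha
  have hℓ : 0 < ℓ := Nat.pos_of_ne_zero fun h => by simpa [h] using n.isLt
  refine ⟨⟨(n : ℕ) / ℓ, Nat.div_lt_of_lt_mul n.isLt⟩,
    Function.ne_iff.mpr ⟨⟨(n : ℕ) % ℓ, Nat.mod_lt _ hℓ⟩, ?_⟩⟩
  change a ⟨(n : ℕ) / ℓ * ℓ + (n : ℕ) % ℓ, _⟩ ≠ 0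
  simpa only [Nat.div_add_mod', ne_eq, Pi.zero_apply] using hn

theorem generalized_semenov_trifonov_bound
    (F K : Type*) [Field F] [Fintype F] [DecidableEq F] [Field K] [Algebra F K]
    (ℓ mA mB : ℕ) (hℓ : 0 < ℓ) (hmA : 0 < mA) (hmB : 0 < mB)
    (hcop : Nat.Coprime mA mB)
    (A : Submodule F (Fin (ℓ * mA) → F))
    (hAqc : IsQuasiCyclic ℓ (A : Set (Fin (ℓ * mA) → F)))
    (GA : Matrix (Fin ℓ) (Fin ℓ) F[X]) (hGA : IsRGBPOT F ℓ mA A GA)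
    (gB : F[X]) (hgB : gB ∣ (X ^ mB - 1))
    (dB : ℕ)
    (hdBlb : ∀ c ∈ cyclicCodeOf F mB gB, c ≠ 0 → dB ≤ hammingNorm c)
    (hdBex : ∃ c ∈ cyclicCodeOf F mB gB, c ≠ 0 ∧ hammingNorm c = dB)
    (α β : K) (hα : orderOf α = mA) (hβ : orderOf β = mB)
    (f1 f2 z1 z2 δ : ℕ) (hz1 : 0 < z1) (hz2 : 0 < z2) (hδ : 2 < δ)
    (hz1c : Nat.Coprime z1 mA) (hz2c : Nat.Coprime z2 mB)
    (E : Set (Fin ℓ → K))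
    (hE : E = { v | ∀ i : ℕ, i ≤ δ - 2 →
        Polynomial.aeval (β ^ (f2 + i * z2)) gB ≠ 0 →
          (GA.map fun p => Polynomial.aeval (α ^ (f1 + i * z1)) p).mulVec v = 0 })
    (hvanish : ∀ a ∈ A, ∀ bb : F[X], bb.degree < (mB : WithBot ℕ) → gB ∣ bb →
        ∀ v ∈ E, ∀ i : ℕ, i ≤ δ - 2 →
          (∑ j, Polynomial.aeval (α ^ (f1 + i * z1)) (polyRep ℓ mA a j) * v j) *
            Polynomial.aeval (β ^ (f2 + i * z2)) bb = 0) :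
    ∀ w : ℕ, w ≤ δ →
      (∀ e : Fin ℓ → F, (∀ v ∈ E, ∑ j, v j * algebraMap F K (e j) = 0) → e ≠ 0 →
          w ≤ hammingNorm e) →
      ∀ a ∈ A, a ≠ 0 → (w + dB - 1) / dB ≤ hammingNorm a := by
  intro w hwδ hw a ha ha0
  obtain ⟨b, hb, hb0, hbw⟩ := hdBex
  have hdB : 0 < dB := hbw ▸ hammingNorm_pos_iff.mpr hb0
  suffices hmain : w ≤ hammingNorm a * dB by
    rw [← Nat.lt_succ_iff, Nat.div_lt_iff_lt_mul hdB, Nat.succ_mul]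
    omega
  by_contra! hlt
  obtain ⟨t, ht⟩ := Function.ne_iff.mp hb0
  obtain ⟨k, hk⟩ := exists_block_ne_zero ha0
  have hgb : gB ∣ vecPolyL F mB b := Ideal.mem_span_singleton.mp hb
  let P : Finset (Fin mA) := Finset.univ.filter fun k =>
    (fun j : Fin ℓ => a ⟨(k : ℕ) * ℓ + (j : ℕ), idx_lt k j⟩) ≠ 0
  let Q : Finset (Fin mB) := Finset.univ.filter fun t => b t ≠ 0
  have hcard : (P ×ˢ Q).card ≤ δ - 1 := by
    have hQ : Q.card = dB := hbw
    have := Nat.mul_le_mul_right dB (card_nonzero_blocks_le a)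
    rw [Finset.card_product, hQ]
    change P.card * dB ≤ _ at this
    omega
  have hcol : ∀ v ∈ E, ∑ j : Fin ℓ,
      v j * algebraMap F K (a ⟨(k : ℕ) * ℓ + (j : ℕ), idx_lt k j⟩) = 0 := by
    intro v hv
    let r : Fin mA → K := fun k =>
      ∑ j : Fin ℓ, v j * algebraMap F K (a ⟨(k : ℕ) * ℓ + (j : ℕ), idx_lt k j⟩)
    have hr : ∀ k ∉ P, r k = 0 := by
      intro k hk
      have hk' : (fun j : Fin ℓ => a ⟨(k : ℕ) * ℓ + (j : ℕ), idx_lt k j⟩) = 0 := by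
        simpa [P] using hk
      exact Finset.sum_eq_zero fun j _ => by simp [show a _ = 0 from congrFun hk' j]
    have hsumA : ∀ x : K, ∑ j, aeval x (polyRep ℓ mA a j) * v j =
        ∑ k ∈ P, r k * x ^ (k : ℕ) := by
      intro x
      rw [Finset.sum_subset P.subset_univ fun k _ hk => by rw [hr k hk, zero_mul]]
      simp_rw [aeval_polyRep, r, Finset.sum_mul]
      rw [Finset.sum_comm]
      exact Finset.sum_congr rfl fun _ _ => Finset.sum_congr rfl fun _ _ => by ring
    have hsumB : ∀ x : K, aeval x (vecPolyL F mB b) =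
        ∑ t ∈ Q, algebraMap F K (b t) * x ^ (t : ℕ) := by
      intro x
      rw [aeval_vecPolyL]
      refine (Finset.sum_subset Q.subset_univ fun t _ ht => ?_).symm
      have : b t = 0 := by simpa [Q] using ht
      rw [this, map_zero, zero_mul]
    have hzero := eq_zero_of_forall_sum_mul_pow_eq_zero (P ×ˢ Q)
      (fun p => (α ^ z1) ^ (p.1 : ℕ) * (β ^ z2) ^ (p.2 : ℕ))
      (fun p => r p.1 * (α ^ f1) ^ (p.1 : ℕ) *
        (algebraMap F K (b p.2) * (β ^ f2) ^ (p.2 : ℕ)))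
      (pow_mul_pow_injective_of_coprime_orderOf hmA hmB hα hβ hcop hz1c hz2c).injOn
      (δ - 1) hcard (fun i hi => by
        have := hvanish a ha _ (degree_vecPolyL_lt b) hgb v hv i (by omega)
        rw [hsumA, hsumB, Finset.sum_mul_sum, ← Finset.sum_product'] at this
        rw [← this]
        exact Finset.sum_congr rfl fun _ _ => by ring)
      (s := (k, t)) (by simpa [P, Q] using ⟨hk, ht⟩)
    have hα0 : α ≠ 0 := fun h => by simp [h] at hα; omega
    have hβ0 : β ≠ 0 := fun h => by simp [h] at hβ; omega
    simpa [hα0, hβ0, show b t ≠ 0 from ht] using hzero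
  have hwk := hw _ hcol hk
  have := hammingNorm_block_le a k
  have := Nat.le_mul_of_pos_right (hammingNorm a) hdB
  omega
end

section
/- (Semenov–Trifonov BCH-like bound.) Let C be an ℓ-quasi-cyclic code over F_q of length ℓ·m with minimum Hamming distance d and generator matrix G(X) in RGB/POT form, and let α ∈ F_{q^s} have multiplicative order m. Let integers f ≥ 0, z > 0, δ > 2 with gcd(z,m) = 1 and set D = { f, f+z, f+2z, …, f+(δ−2)z }. For each i ∈ D let E_i = { v ∈ F_{q^s}^ℓ : G(α^i)·v = 0 }, let E = ∩_{i ∈ D} E_i, and let d^ec be the minimum distance of the eigencode C(E). Assume that for every codeword c ∈ C (with polynomial-vector representation (c_0(X),…,c_{ℓ−1}(X))), every v ∈ E, and every i ∈ [0, δ−2]: Σ_{j=0}^{ℓ−1} c_j(α^{f+i·z})·v_j = 0. Then d ≥ min(δ, d^ec) (where min(δ, d^ec) = δ if C(E) = {0}). -/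
open Polynomial

/-- A power-sum (Vandermonde) system with distinct nodes and at least as many equations as unknowns
has only the trivial solution. -/
lemma eq_zero_of_sum_mul_pow_eq_zero {ι K : Type*} [Field K] (s : Finset ι)
    (x b : ι → K) (hx : Set.InjOn x s)
    (h : ∀ t < s.card, ∑ i ∈ s, b i * x i ^ t = 0) : ∀ i ∈ s, b i = 0 := by
  classical
  intro k hk
  set p : K[X] := ∏ j ∈ s.erase k, (X - C (x j)) with hp
  have hdeg : p.natDegree < s.card := by
    rw [hp, natDegree_finsetProd_X_sub_C_eq_card, Finset.card_erase_of_mem hk]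
    exact Nat.sub_lt (Finset.card_pos.2 ⟨k, hk⟩) one_pos
  have hsum : ∑ i ∈ s, b i * p.eval (x i) = 0 := by
    simp_rw [eval_eq_sum_range' hdeg, Finset.mul_sum]
    rw [Finset.sum_comm]
    refine Finset.sum_eq_zero fun t ht => ?_
    rw [← mul_zero (p.coeff t), ← h t (Finset.mem_range.1 ht), Finset.mul_sum]
    exact Finset.sum_congr rfl fun i _ => by ring
  rw [Finset.sum_eq_single_of_mem k hk] at hsum
  · refine (mul_eq_zero.1 hsum).resolve_right ?_
    rw [hp, eval_prod]
    refine Finset.prod_ne_zero_iff.2 fun j hj => ?_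
    rw [eval_sub, eval_X, eval_C, sub_ne_zero]
    exact fun hkj => Finset.ne_of_mem_erase hj (hx (Finset.mem_of_mem_erase hj) hk hkj.symm)
  · intro i hi hik
    rw [hp, eval_prod, Finset.prod_eq_zero (Finset.mem_erase.2 ⟨hik, hi⟩) (by simp), mul_zero]

/-- The `i`-th block of length `ℓ` of a word of length `ℓm`. -/
def wordBlock {F : Type*} {ℓ m : ℕ} (c : Fin (ℓ * m) → F) (i : Fin m) : Fin ℓ → F :=
  fun j => c ⟨(i : ℕ) * ℓ + (j : ℕ), idx_lt i j⟩

lemma hammingNorm_wordBlock_le {F : Type*} [Zero F] [DecidableEq F] {ℓ m : ℕ}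
    (c : Fin (ℓ * m) → F) (i : Fin m) : hammingNorm (wordBlock c i) ≤ hammingNorm c := by
  refine Finset.card_le_card_of_injOn
    (fun j => (⟨(i : ℕ) * ℓ + (j : ℕ), idx_lt i j⟩ : Fin (ℓ * m))) ?_ ?_
  · intro j hj
    simpa [wordBlock] using (Finset.mem_filter.1 hj).2
  · intro j _ k _ hjk
    simpa [Fin.ext_iff] using hjk

lemma exists_wordBlock_apply_eq {F : Type*} {ℓ m : ℕ} (c : Fin (ℓ * m) → F) (k : Fin (ℓ * m)) :
    ∃ (i : Fin m) (j : Fin ℓ), wordBlock c i j = c k := by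
  have hℓ : 0 < ℓ := Nat.pos_of_mul_pos_right k.pos
  refine ⟨⟨(k : ℕ) / ℓ, Nat.div_lt_of_lt_mul k.isLt⟩, ⟨(k : ℕ) % ℓ, Nat.mod_lt _ hℓ⟩, ?_⟩
  exact congrArg c (Fin.ext (Nat.div_add_mod' _ _))

lemma card_wordBlock_ne_zero_le {F : Type*} [Zero F] [DecidableEq F] {ℓ m : ℕ}
    (c : Fin (ℓ * m) → F) : (Finset.univ.filter fun i : Fin m => wordBlock c i ≠ 0).card ≤ hammingNorm c := by
  rcases isEmpty_or_nonempty (Fin ℓ) with _ | _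
  · simp [Subsingleton.elim (wordBlock c _) 0]
  have hex (i : Fin m) (hi : wordBlock c i ≠ 0) : ∃ j, wordBlock c i j ≠ 0 :=
    Function.ne_iff.1 hi
  choose! j hj using hex
  refine Finset.card_le_card_of_injOn
    (fun i => (⟨(i : ℕ) * ℓ + (j i : ℕ), idx_lt i (j i)⟩ : Fin (ℓ * m))) ?_ ?_
  · intro i hi
    simpa [wordBlock] using hj i (Finset.mem_filter.1 hi).2
  · intro i _ k _ hik
    have h : (i : ℕ) * ℓ + (j i : ℕ) = (k : ℕ) * ℓ + (j k : ℕ) := congrArg Fin.val hik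
    have hℓ : 0 < ℓ := (j i).pos
    have hdiv (i : Fin m) (j : Fin ℓ) : ((i : ℕ) * ℓ + (j : ℕ)) / ℓ = i := by
      rw [Nat.mul_comm, Nat.mul_add_div hℓ, Nat.div_eq_of_lt j.isLt, Nat.add_zero]
    exact Fin.ext (by rw [← hdiv i (j i), h, hdiv])

lemma sum_aeval_polyRep_mul {F K : Type*} [Field F] [Field K] [Algebra F K] {ℓ m : ℕ}
    (c : Fin (ℓ * m) → F) (v : Fin ℓ → K) (y : K) :
    ∑ j, aeval y (polyRep ℓ m c j) * v j =
      ∑ i : Fin m, (∑ j, v j * algebraMap F K (wordBlock c i j)) * y ^ (i : ℕ) := by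
  simp_rw [polyRep, map_sum, aeval_monomial, Finset.sum_mul]
  rw [Finset.sum_comm]
  refine Finset.sum_congr rfl fun i _ => Finset.sum_congr rfl fun j _ => ?_
  rw [wordBlock]
  ring

theorem semenov_trifonov_bch_like_bound
    (F K : Type*) [Field F] [Fintype F] [DecidableEq F] [Field K] [Algebra F K]
    (ℓ m : ℕ) (hℓ : 0 < ℓ) (hm : 0 < m)
    (C : Submodule F (Fin (ℓ * m) → F))
    (hCqc : IsQuasiCyclic ℓ (C : Set (Fin (ℓ * m) → F)))
    (G : Matrix (Fin ℓ) (Fin ℓ) F[X]) (hG : IsRGBPOT F ℓ m C G)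
    (α : K) (hα : orderOf α = m)
    (f z δ : ℕ) (hz : 0 < z) (hδ : 2 < δ) (hzc : Nat.Coprime z m)
    (E : Set (Fin ℓ → K))
    (hE : E = { v | ∀ i : ℕ, i ≤ δ - 2 →
        (G.map fun p => Polynomial.aeval (α ^ (f + i * z)) p).mulVec v = 0 })
    (hvanish : ∀ c ∈ C, ∀ v ∈ E, ∀ i : ℕ, i ≤ δ - 2 →
        ∑ j, Polynomial.aeval (α ^ (f + i * z)) (polyRep ℓ m c j) * v j = 0) :
    ∀ w : ℕ, w ≤ δ →
      (∀ e : Fin ℓ → F, (∀ v ∈ E, ∑ j, v j * algebraMap F K (e j) = 0) → e ≠ 0 →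
          w ≤ hammingNorm e) →
      ∀ c ∈ C, c ≠ 0 → w ≤ hammingNorm c := by
  classical
  intro w hw hec c hc hc0
  by_contra! hlt
  obtain ⟨k, hk⟩ := Function.ne_iff.1 hc0
  obtain ⟨i₀, j₀, hij⟩ := exists_wordBlock_apply_eq c k
  have hi₀ : wordBlock c i₀ ≠ 0 := Function.ne_iff.2 ⟨j₀, by rw [hij]; exact hk⟩
  refine (((hec _ ?_ hi₀).trans (hammingNorm_wordBlock_le c i₀)).not_gt hlt).elim
  intro v hv
  set s := Finset.univ.filter fun i : Fin m => wordBlock c i ≠ 0 with hs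
  have hcard : s.card < δ := (card_wordBlock_ne_zero_le c).trans_lt (hlt.trans_le hw)
  have hα0 : α ≠ 0 := by
    rintro rfl
    simp at hα
    omega
  have hinj : Set.InjOn (fun i : Fin m => (α ^ z) ^ (i : ℕ)) s := by
    intro i _ k _ hik
    have hord : orderOf (α ^ z) = m := by
      rw [Nat.Coprime.orderOf_pow (hα ▸ hzc.symm), hα]
    exact Fin.ext (pow_injOn_Iio_orderOf (by simp [hord]) (by simp [hord]) hik)
  have hmain := eq_zero_of_sum_mul_pow_eq_zero s (fun i : Fin m => (α ^ z) ^ (i : ℕ))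
    (fun i => (∑ j, v j * algebraMap F K (wordBlock c i j)) * (α ^ f) ^ (i : ℕ)) hinj
    (fun t ht => by
      rw [← hvanish c hc v hv t (by omega), sum_aeval_polyRep_mul]
      refine (Finset.sum_congr rfl fun i _ => ?_).trans
        (Finset.sum_subset (Finset.subset_univ s) fun i _ hi => ?_)
      · ring
      · have hi0 : wordBlock c i = 0 := by simpa [hs] using hi
        simp [hi0])
    i₀ (by simpa [hs] using hi₀)
  exact (mul_eq_zero.1 hmain).resolve_right (pow_ne_zero _ (pow_ne_zero _ hα0))
end

section
/- Let A ⊆ F_q^{nA} be an ℓA-quasi-cyclic linear code with nA = ℓA·mA and B ⊆ F_q^{nB} an ℓB-quasi-cyclic linear code with nB = ℓB·mB, where gcd(nA,nB) = 1. Fix integers a, b with a·nA + b·nB = 1, set n = nA·nB and I(i,j) = (i·a·nA·ℓA + j·b·nB·ℓB) mod n. Then: (i) I is a bijection from [0,nB)×[0,nA) onto [0,n); and (ii) the set C = { c ∈ F_q^n : there exists a matrix (m_{i,j}) in the product code A⊗B with c_{I(i,j)} = m_{i,j} for all i ∈ [0,nB), j ∈ [0,nA) } is an ℓA·ℓB-quasi-cyclic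 linear code of length n. -/
open Polynomial

theorem intModFin_coe (n : ℕ) (hn : 0 < n) (t : ℤ) : ((intModFin n hn t : ℕ) : ℤ) = t % n :=
  Int.toNat_of_nonneg (Int.emod_nonneg t (by exact_mod_cast hn.ne'))

theorem intModFin_eq_iff {n : ℕ} {hn : 0 < n} {s t : ℤ} :
    intModFin n hn s = intModFin n hn t ↔ s ≡ t [ZMOD n] := by
  rw [Int.ModEq, ← intModFin_coe n hn s, ← intModFin_coe n hn t, Fin.ext_iff, Nat.cast_inj]

/-- Adding a natural number modulo `n` commutes with reduction modulo `n`. -/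
theorem intModFin_add_mod {n : ℕ} {hn : 0 < n} (t : ℤ) (r : ℕ)
    (h : ((intModFin n hn t : ℕ) + r) % n < n) :
    (⟨((intModFin n hn t : ℕ) + r) % n, h⟩ : Fin n) = intModFin n hn (t + r) := by
  apply Fin.ext
  rw [← Nat.cast_inj (R := ℤ), intModFin_coe]
  push_cast
  rw [intModFin_coe, Int.emod_add_emod]

/-- A factor coprime to the modulus can be cancelled from a congruence of residues. -/
theorem Fin.eq_of_modEq_mul {n : ℕ} {l : ℤ} (hl : IsCoprime (n : ℤ) l) {i j : Fin n}
    (h : (n : ℤ) ∣ ((i : ℤ) - j) * l) : i = j := by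
  have h' : (j : ℤ) ≡ i [ZMOD n] := Int.modEq_iff_dvd.2 (hl.dvd_of_dvd_mul_right h)
  exact Fin.ext ((Int.natCast_modEq_iff.1 h').symm.eq_of_lt_of_lt i.isLt j.isLt)

/-- The serialization of an array by the Chinese remainder theorem is a bijection. -/
theorem crtIndex_bijective {nA nB : ℕ} (hn : 0 < nA * nB) {a b u v : ℤ}
    (hab : a * nA + b * nB = 1) (hu : IsCoprime (nB : ℤ) u) (hv : IsCoprime (nA : ℤ) v) :
    Function.Bijective (fun p : Fin nB × Fin nA =>
      intModFin (nA * nB) hn ((p.1 : ℤ) * (a * nA * u) + (p.2 : ℤ) * (b * nB * v))) := by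
  rw [Fintype.bijective_iff_injective_and_card]
  refine ⟨?_, by simp [mul_comm]⟩
  rintro ⟨i, j⟩ ⟨i', j'⟩ h
  simp only [intModFin_eq_iff] at h
  obtain ⟨k, hk⟩ := h.symm.dvd
  push_cast at hk
  refine Prod.ext (Fin.eq_of_modEq_mul hu ?_) (Fin.eq_of_modEq_mul hv ?_)
  · exact ⟨nA * k + b * (i - i') * u - b * (j - j') * v, by
      linear_combination hk - (i - i') * u * hab⟩
  · exact ⟨nB * k + a * (j - j') * v - a * (i - i') * u, by
      linear_combination hk - (j - j') * v * hab⟩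

/-- Shifting the row index by `v` and the column index by `u` shifts the serialized index
by `u * v`. -/
theorem crtIndex_shift {nA nB : ℕ} {a b : ℤ} {u v : ℕ} (hab : a * nA + b * nB = 1) (i j : ℕ) :
    (i : ℤ) * (a * nA * u) + (j : ℤ) * (b * nB * v) + (u * v : ℕ) ≡
      (((i + v) % nB : ℕ) : ℤ) * (a * nA * u) + (((j + u) % nA : ℕ) : ℤ) * (b * nB * v)
      [ZMOD (nA * nB : ℕ)] := by
  have hi : ((i + v : ℕ) : ℤ) = nB * ((i + v) / nB : ℕ) + ((i + v) % nB : ℕ) := by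
    exact_mod_cast (Nat.div_add_mod _ _).symm
  have hj : ((j + u : ℕ) : ℤ) = nA * ((j + u) / nA : ℕ) + ((j + u) % nA : ℕ) := by
    exact_mod_cast (Nat.div_add_mod _ _).symm
  refine Int.ModEq.symm (Int.modEq_iff_dvd.2
    ⟨((i + v) / nB : ℕ) * a * u + ((j + u) / nA : ℕ) * b * v, ?_⟩)
  simp only [Nat.cast_add, Nat.cast_mul] at hi hj ⊢
  linear_combination (a * nA * u) * hi + (b * nB * v) * hj - (u * v : ℤ) * hab

theorem quasi_cyclic_product_code_serialization
    (F : Type*) [Field F] [Fintype F]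
    (ℓA mA ℓB mB : ℕ) (hℓA : 0 < ℓA) (hmA : 0 < mA) (hℓB : 0 < ℓB) (hmB : 0 < mB)
    (A : Submodule F (Fin (ℓA * mA) → F)) (B : Submodule F (Fin (ℓB * mB) → F))
    (hAqc : IsQuasiCyclic ℓA (A : Set (Fin (ℓA * mA) → F)))
    (hBqc : IsQuasiCyclic ℓB (B : Set (Fin (ℓB * mB) → F)))
    (hcop : Nat.Coprime (ℓA * mA) (ℓB * mB))
    (a b : ℤ) (hab : a * (ℓA * mA) + b * (ℓB * mB) = 1) :
    Function.Bijective (fun p : Fin (ℓB * mB) × Fin (ℓA * mA) =>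
        intModFin ((ℓA * mA) * (ℓB * mB))
          (Nat.mul_pos (Nat.mul_pos hℓA hmA) (Nat.mul_pos hℓB hmB))
          ((p.1 : ℤ) * (a * (ℓA * mA) * ℓA) + (p.2 : ℤ) * (b * (ℓB * mB) * ℓB)))
    ∧ ∃ Cc : Submodule F (Fin ((ℓA * mA) * (ℓB * mB)) → F),
        (Cc : Set (Fin ((ℓA * mA) * (ℓB * mB)) → F))
          = { c | ∃ M : Fin (ℓB * mB) → Fin (ℓA * mA) → F,
              IsProductCW (A : Set _) (B : Set _) M ∧
              ∀ (i : Fin (ℓB * mB)) (j : Fin (ℓA * mA)),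
                c (intModFin ((ℓA * mA) * (ℓB * mB))
                    (Nat.mul_pos (Nat.mul_pos hℓA hmA) (Nat.mul_pos hℓB hmB))
                    ((i : ℤ) * (a * (ℓA * mA) * ℓA) + (j : ℤ) * (b * (ℓB * mB) * ℓB))) = M i j }
        ∧ IsQuasiCyclic (ℓA * ℓB) (Cc : Set (Fin ((ℓA * mA) * (ℓB * mB)) → F)) := by
  have hab' : a * ((ℓA * mA : ℕ) : ℤ) + b * ((ℓB * mB : ℕ) : ℤ) = 1 := by
    push_cast
    exact hab
  have hu : IsCoprime ((ℓB * mB : ℕ) : ℤ) (ℓA : ℤ) :=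
    Nat.isCoprime_iff_coprime.2 hcop.coprime_mul_right.symm
  have hv : IsCoprime ((ℓA * mA : ℕ) : ℤ) (ℓB : ℤ) :=
    Nat.isCoprime_iff_coprime.2 hcop.coprime_mul_right_right
  have hn : 0 < (ℓA * mA) * (ℓB * mB) :=
    Nat.mul_pos (Nat.mul_pos hℓA hmA) (Nat.mul_pos hℓB hmB)
  have hshift := fun i j : ℕ => crtIndex_shift (u := ℓA) (v := ℓB) hab' i j
  simp only [← Nat.cast_mul] at hshift ⊢
  refine ⟨crtIndex_bijective hn hab' hu hv,
    { carrier := _, zero_mem' := ?_, add_mem' := ?_, smul_mem' := ?_ }, rfl, ?_⟩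
  · rintro c d ⟨M, ⟨hMA, hMB⟩, hc⟩ ⟨N, ⟨hNA, hNB⟩, hd⟩
    exact ⟨M + N, ⟨fun i => A.add_mem (hMA i) (hNA i), fun j => B.add_mem (hMB j) (hNB j)⟩,
      fun i j => congrArg₂ (· + ·) (hc i j) (hd i j)⟩
  · exact ⟨0, ⟨fun _ => A.zero_mem, fun _ => B.zero_mem⟩, fun _ _ => rfl⟩
  · rintro r c ⟨M, ⟨hMA, hMB⟩, hc⟩
    exact ⟨r • M, ⟨fun i => A.smul_mem r (hMA i), fun j => B.smul_mem r (hMB j)⟩,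
      fun i j => congrArg (r • ·) (hc i j)⟩
  · rintro c ⟨M, ⟨hMA, hMB⟩, hc⟩
    refine ⟨fun i j => M ⟨(i + ℓB) % (ℓB * mB), Nat.mod_lt _ i.pos⟩
      ⟨(j + ℓA) % (ℓA * mA), Nat.mod_lt _ j.pos⟩,
      ⟨fun i => hAqc _ (hMA _), fun j => hBqc _ (hMB _)⟩, fun i j => ?_⟩
    refine Eq.trans (congrArg c ?_) (hc _ _)
    exact (intModFin_add_mod _ _ _).trans (intModFin_eq_iff.2 (hshift i j))
end

section
/- Let nA = ℓA·mA and nB = ℓB·mB with gcd(nA,nB) = 1, let a, b be integers with a·nA + b·nB = 1, and set n = nA·nB, m = mA·mB, ℓ = ℓA·ℓB. For an arbitrary matrix M = (m_{i,j}) ∈ F_q^{nB×nA}, define for each g ∈ [0,ℓB) and h ∈ [0,ℓA) the polynomial c_{g,h}(X) ≡ X^{s(g,h)}·Σ_{i=0}^{mB−1}Σ_{j=0}^{mA−1} m_{i·ℓB+g, j·ℓA+h}·X^{μ(i,j)} mod (X^m−1), where μ(i,j) = (i·a·nA + j·b·nB) mod m and s(g,h) = (−g·b·mB − h·a·mA)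 mod m. Then Σ_{g=0}^{ℓB−1} Σ_{h=0}^{ℓA−1} c_{g,h}(X^ℓ)·X^{g·ℓA + h·ℓB} ≡ Σ_{i=0}^{nB−1} Σ_{j=0}^{nA−1} m_{i,j}·X^{I(i,j)} mod (X^n−1), where I(i,j) = (i·a·nA·ℓA + j·b·nB·ℓB) mod n. -/
open Polynomial

lemma sum_fin_mul {R : Type*} [AddCommMonoid R] {ℓ m : ℕ} (f : Fin (ℓ * m) → R) :
    ∑ k, f k = ∑ g : Fin ℓ, ∑ i : Fin m, f ⟨(i : ℕ) * ℓ + (g : ℕ), idx_lt i g⟩ := by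
  rw [Finset.sum_comm, ← Fintype.sum_prod_type',
    ← (finProdFinEquiv.trans (finCongr (Nat.mul_comm m ℓ))).sum_comp]
  refine Fintype.sum_congr _ _ fun p => congrArg f (Fin.ext ?_)
  simp [finProdFinEquiv]
  ring

lemma natMod_cast_modEq {m : ℕ} (hm : 0 < m) (t : ℤ) : (natMod m t : ℤ) ≡ t [ZMOD m] := by
  rw [natMod, Int.toNat_of_nonneg (Int.emod_nonneg t (by exact_mod_cast hm.ne'))]
  exact Int.mod_modEq t m

lemma X_pow_sub_one_dvd_X_pow_sub_X_pow {R : Type*} [CommRing R] {n u v : ℕ}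
    (h : (u : ℤ) ≡ v [ZMOD n]) : (X ^ n - 1 : R[X]) ∣ X ^ u - X ^ v := by
  wlog huv : v ≤ u generalizing u v
  · rw [dvd_sub_comm]
    exact this h.symm (by omega)
  obtain ⟨k, hk⟩ := (Nat.modEq_iff_dvd' huv).1 (Int.natCast_modEq_iff.1 h).symm
  obtain rfl : u = v + n * k := by omega
  have hd : (X ^ n - 1 : R[X]) ∣ (X ^ n) ^ k - 1 := by
    simpa using sub_dvd_pow_sub_pow (X ^ n : R[X]) 1 k
  rw [pow_add, pow_mul, ← mul_sub_one]
  exact hd.mul_left _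

theorem mapping_to_l_univariate_polynomials
    (F : Type*) [Field F]
    (ℓA mA ℓB mB : ℕ) (hℓA : 0 < ℓA) (hmA : 0 < mA) (hℓB : 0 < ℓB) (hmB : 0 < mB)
    (hcop : Nat.Coprime (ℓA * mA) (ℓB * mB))
    (a b : ℤ) (hab : a * (ℓA * mA) + b * (ℓB * mB) = 1)
    (M : Fin (ℓB * mB) → Fin (ℓA * mA) → F)
    (c : Fin ℓB → Fin ℓA → F[X])
    (hc : ∀ (g : Fin ℓB) (h : Fin ℓA),
      (X ^ (mA * mB) - 1 : F[X]) ∣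
        (c g h -
          X ^ natMod (mA * mB) (-(g : ℤ) * b * mB - (h : ℤ) * a * mA) *
            ∑ i : Fin mB, ∑ j : Fin mA,
              Polynomial.C (M ⟨(i : ℕ) * ℓB + (g : ℕ), idx_lt i g⟩
                              ⟨(j : ℕ) * ℓA + (h : ℕ), idx_lt j h⟩) *
                X ^ natMod (mA * mB) ((i : ℤ) * (a * (ℓA * mA)) + (j : ℤ) * (b * (ℓB * mB))))) :
    (X ^ ((ℓA * mA) * (ℓB * mB)) - 1 : F[X]) ∣
      ((∑ g : Fin ℓB, ∑ h : Fin ℓA,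
          (c g h).comp (X ^ (ℓA * ℓB)) * X ^ ((g : ℕ) * ℓA + (h : ℕ) * ℓB)) -
        ∑ i : Fin (ℓB * mB), ∑ j : Fin (ℓA * mA),
          Polynomial.C (M i j) *
            X ^ natMod ((ℓA * mA) * (ℓB * mB))
              ((i : ℤ) * (a * (ℓA * mA) * ℓA) + (j : ℤ) * (b * (ℓB * mB) * ℓB))) := by
  have hm : 0 < mA * mB := Nat.mul_pos hmA hmB
  have hn : 0 < (ℓA * mA) * (ℓB * mB) := by positivity
  rw [sum_fin_mul]
  simp_rw [sum_fin_mul (ℓ := ℓA) (m := mA)]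
  have hswap : ∀ f : Fin mB → Fin ℓA → Fin mA → F[X],
      ∑ i, ∑ h, ∑ j, f i h j = ∑ h, ∑ i, ∑ j, f i h j := fun f => Finset.sum_comm
  simp_rw [hswap, ← Finset.sum_sub_distrib]
  refine Finset.dvd_sum fun g _ => Finset.dvd_sum fun h _ => ?_
  have hcomp := (map_dvd (compRingHom (X ^ (ℓA * ℓB) : F[X])) (hc g h)).mul_right
    (X ^ ((g : ℕ) * ℓA + (h : ℕ) * ℓB))
  have hexp : (ℓA * ℓB) * (mA * mB) = (ℓA * mA) * (ℓB * mB) := by ring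
  simp only [coe_compRingHom_apply, sub_comp, mul_comp, pow_comp, X_comp, one_comp,
    Polynomial.sum_comp, C_comp, ← pow_mul, hexp, sub_mul] at hcomp
  refine (dvd_iff_dvd_of_dvd_sub ?_).1 hcomp
  rw [sub_sub_sub_cancel_left, Finset.mul_sum, Finset.sum_mul, ← Finset.sum_sub_distrib]
  refine Finset.dvd_sum fun i _ => ?_
  rw [Finset.mul_sum, Finset.sum_mul, ← Finset.sum_sub_distrib]
  refine Finset.dvd_sum fun j _ => ?_
  rw [mul_left_comm (X ^ _), mul_assoc (C _), ← mul_sub, ← pow_add, ← pow_add]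
  refine (X_pow_sub_one_dvd_X_pow_sub_X_pow ?_).mul_left _
  refine (natMod_cast_modEq hn _).trans ?_
  have hs := ((natMod_cast_modEq hm (-(g : ℤ) * b * mB - (h : ℤ) * a * mA)).add
    (natMod_cast_modEq hm
      ((i : ℤ) * (a * (ℓA * mA)) + (j : ℤ) * (b * (ℓB * mB))))).mul_left' (c := ℓA * ℓB)
  have hs' := (hs.add_right ((g : ℤ) * ℓA + (h : ℤ) * ℓB)).symm
  push_cast at hs' ⊢
  convert hs' using 1
  · ring
  · linear_combination ((g : ℤ) * ℓA + (h : ℤ) * ℓB) * hab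
  · ring
end

section
/- Let gcd(mA, mB) = 1 and gcd(mA·mB, q) = 1, set m = mA·mB, nA = ℓ·mA, nB = mB, and let a, b be integers with a·nA + b·nB = 1. Let f, h ∈ F_q[X], and in F_q[X]/(X^m−1) form the residue P = f(X^{b·nB})·h(X^{a·nA}) (substitution convention); let g(X) = gcd(X^m−1, P) ∈ F_q[X]. Let F_{q^s} be an extension of F_q containing an element α of multiplicative order mA and an element β of multiplicative order mB, and set γ = α·β. Then for every integer z: g(γ^z) = 0 if and only if f(α^z) = 0 or h(β^z) = 0. -/
open Polynomial

/-- At a zero of `p`, the gcd of `p` and `q` vanishes exactly when `q` does. -/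
lemma IsMonicGcd.aeval_eq_zero_iff {F K : Type*} [Field F] [Field K] [Algebra F K]
    {p q g : F[X]} (hg : IsMonicGcd p q g) {x : K} (hp : aeval x p = 0) :
    aeval x g = 0 ↔ aeval x q = 0 := by
  classical
  obtain ⟨-, -, hgq, hmax⟩ := hg
  refine ⟨fun h ↦ aeval_eq_zero_of_dvd_aeval_eq_zero hgq h, fun hq ↦ ?_⟩
  refine aeval_eq_zero_of_dvd_aeval_eq_zero
    (hmax _ (EuclideanDomain.gcd_dvd_left p q) (EuclideanDomain.gcd_dvd_right p q)) ?_
  rw [EuclideanDomain.gcd_eq_gcd_ab p q, map_add, map_mul, map_mul, hp, hq, zero_mul, zero_mul,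
    add_zero]

/-- An `m`-th root of unity `x` induces the evaluation map `F[X]/(X^m - 1) → K`, `X ↦ x`. -/
noncomputable def QR.evalAt {F K : Type*} [Field F] [Field K] [Algebra F K] {m : ℕ}
    (x : K) (hx : x ^ m = 1) : QR F m →ₐ[F] K :=
  AdjoinRoot.liftAlgHom (X ^ m - 1 : F[X]) (Algebra.ofId F K) x (by simp [hx])

lemma QR.evalAt_qmk {F K : Type*} [Field F] [Field K] [Algebra F K] {m : ℕ} {x : K}
    (hx : x ^ m = 1) (r : F[X]) : QR.evalAt x hx (qmk F m r) = aeval x r :=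
  AdjoinRoot.liftAlgHom_mk (X ^ m - 1 : F[X]) (Algebra.ofId F K) x (by simp [hx]) r

lemma QR.evalAt_substX {F K : Type*} [Field F] [Field K] [Algebra F K] {m : ℕ} (hm : 0 < m)
    {x : K} (hx : x ^ m = 1) (t : ℤ) (f : F[X]) :
    QR.evalAt x hx (substX F m t f) = aeval (x ^ t) f := by
  have hpow : QR.evalAt x hx (zX F m t) = x ^ t := by
    have hnonneg : 0 ≤ t % (m : ℤ) := Int.emod_nonneg t (by exact_mod_cast hm.ne')
    rw [zX, QR.evalAt_qmk, map_pow, aeval_X, ← zpow_natCast, Int.toNat_of_nonneg hnonneg]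
    have hx0 : x ≠ 0 := by rintro rfl; simp [hm.ne'] at hx
    conv_rhs => rw [← Int.emod_add_mul_ediv t m, zpow_add₀ hx0, zpow_mul, zpow_natCast, hx,
      one_zpow, mul_one]
  rw [substX, ← aeval_algHom_apply, hpow]

/-- If `u + v = 1`, `α ^ u = 1` and `β ^ v = 1`, then the power `v` projects `(αβ)^z` to `α^z`. -/
lemma mul_zpow_zpow_eq_left {K : Type*} [Field K] {α β : K} (hα : α ≠ 0) {u v : ℤ}
    (huv : u + v = 1) (hu : α ^ u = 1) (hv : β ^ v = 1) (z : ℤ) :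
    ((α * β) ^ z) ^ v = α ^ z := by
  have hαv : α ^ v = α := by
    rw [eq_sub_of_add_eq' huv, zpow_sub₀ hα, hu, zpow_one, div_one]
  rw [zpow_comm, mul_zpow, hαv, hv, mul_one]

theorem gcd_root_characterization
    (F K : Type*) [Field F] [Fintype F] [Field K] [Algebra F K]
    (ℓ mA mB : ℕ) (hℓ : 0 < ℓ) (hmA : 0 < mA) (hmB : 0 < mB)
    (hcop : Nat.Coprime mA mB) (hchar : Nat.Coprime (mA * mB) (Fintype.card F))
    (a b : ℤ) (hab : a * (ℓ * mA) + b * mB = 1)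
    (f p : F[X]) (r : F[X])
    (hr : qmk F (mA * mB) r
      = substX F (mA * mB) (b * mB) f * substX F (mA * mB) (a * (ℓ * mA)) p)
    (g : F[X]) (hg : IsMonicGcd (X ^ (mA * mB) - 1) r g)
    (α β : K) (hα : orderOf α = mA) (hβ : orderOf β = mB) :
    ∀ z : ℤ, Polynomial.aeval ((α * β) ^ z) g = 0 ↔
      (Polynomial.aeval (α ^ z) f = 0 ∨ Polynomial.aeval (β ^ z) p = 0) := by
  intro z
  have hαA : α ^ mA = 1 := hα ▸ pow_orderOf_eq_one α
  have hβB : β ^ mB = 1 := hβ ▸ pow_orderOf_eq_one β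
  have hα0 : α ≠ 0 := by rintro rfl; simp [hmA.ne'] at hαA
  have hβ0 : β ≠ 0 := by rintro rfl; simp [hmB.ne'] at hβB
  have hαu : α ^ (a * (ℓ * mA)) = 1 := by
    rw [← mul_assoc, mul_comm, zpow_mul, zpow_natCast, hαA, one_zpow]
  have hβv : β ^ (b * mB) = 1 := by
    rw [mul_comm, zpow_mul, zpow_natCast, hβB, one_zpow]
  have hx : ((α * β) ^ z) ^ (mA * mB) = 1 := by
    have hαβ : (α * β) ^ (mA * mB) = 1 := by
      rw [mul_pow, pow_mul, hαA, one_pow, mul_comm mA, pow_mul, hβB, one_pow, one_mul]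
    rw [← zpow_natCast, zpow_comm, zpow_natCast, hαβ, one_zpow]
  have hr_eval := congrArg (QR.evalAt ((α * β) ^ z) hx) hr
  rw [map_mul, QR.evalAt_qmk, QR.evalAt_substX (Nat.mul_pos hmA hmB),
    QR.evalAt_substX (Nat.mul_pos hmA hmB), mul_zpow_zpow_eq_left hα0 hab hαu hβv, mul_comm α β,
    mul_zpow_zpow_eq_left hβ0 (by rwa [add_comm]) hβv hαu, mul_comm β α] at hr_eval
  rw [hg.aeval_eq_zero_iff (by simp [hx]), hr_eval, mul_eq_zero]
end

section
/- Let gcd(mA, mB) = 1, set m = mA·mB, nA = ℓ·mA, nB = mB, and let a, b be integers with a·nA + b·nB = 1. Let G^A(X) = (g^A_{h,h'}(X)) ∈ F_q[X]^{ℓ×ℓ} be upper triangular, and let g^B ∈ F_q[X]. For each h ∈ [0,ℓ), fix u_h, v_h ∈ F_q[X] with g_{h,h}(X) = u_h(X)·(X^m−1) + v_h(X)·g^A_{h,h}(X^{b·nB})·g^B(X^{a·nA}), and define the upper-triangular matrix Ḡ(X) ∈ (F_q[X]/(X^m−1))^{ℓ×ℓ} with diagonal entries g_{h,h}(X) and off-diagonal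 entries ḡ_{h,h'}(X) = v_h(X)·g^A_{h,h'}(X^{b·nB})·g^B(X^{a·nA}) for h' > h (substitution convention). Let F_{q^s} contain α of multiplicative order mA and β of multiplicative order mB, and set γ = α·β. Then for every integer z: Ḡ(γ^z) = diag(v_0(γ^z), v_1(γ^z), …, v_{ℓ−1}(γ^z)) · G^A(α^z) · g^B(β^z). Consequently, the right kernel of G^A(α^z) is contained in the right kernel of Ḡ(γ^z). -/
open Polynomial

/-- Evaluation of a residue in `F[X]/(X^m - 1)` at an `m`-th root of unity. -/
noncomputable def evalQR {F K : Type*} [Field F] [Field K] [Algebra F K] {m : ℕ} {x : K}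
    (hx : x ^ m = 1) : QR F m →+* K :=
  AdjoinRoot.lift (algebraMap F K) x (by simp [hx])

section evalQR

variable {F K : Type*} [Field F] [Field K] [Algebra F K] {m : ℕ} {x : K}

lemma evalQR_qmk (hx : x ^ m = 1) (f : F[X]) : evalQR hx (qmk F m f) = aeval x f :=
  AdjoinRoot.lift_mk _ _

lemma zpow_toNat_emod (hm : 0 < m) (hx : x ^ m = 1) (t : ℤ) :
    x ^ (t % (m : ℤ)).toNat = x ^ t := by
  have hnonneg : 0 ≤ t % (m : ℤ) := Int.emod_nonneg t (by exact_mod_cast hm.ne')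
  have hx0 : x ≠ 0 := by
    rintro rfl
    simp [hm.ne'] at hx
  rw [← zpow_natCast, Int.toNat_of_nonneg hnonneg]
  conv_rhs => rw [← Int.emod_add_mul_ediv t m]
  rw [zpow_add₀ hx0, zpow_mul, zpow_natCast, hx, one_zpow, mul_one]

lemma evalQR_substX (hm : 0 < m) (hx : x ^ m = 1) (t : ℤ) (f : F[X]) :
    evalQR hx (substX F m t f) = aeval (x ^ t) f := by
  have hz : evalQR hx (zX F m t) = x ^ t := by
    rw [zX, evalQR_qmk, map_pow, aeval_X, zpow_toNat_emod hm hx]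
  have hc : (evalQR hx).comp (algebraMap F (QR F m)) = algebraMap F K := by
    ext c
    exact AdjoinRoot.lift_of (f := (X ^ m - 1 : F[X])) (by simp [hx])
  rw [substX, aeval_def, hom_eval₂, hc, hz, aeval_def]

end evalQR

/-- If `x ^ m = y ^ n = 1` and `s + t = 1` with `m ∣ s`, `n ∣ t`, then `(x * y) ^ t` recovers `x`. -/
lemma mul_zpow_eq_left {K : Type*} [Field K] {x y : K} {m n : ℕ} (hx0 : x ≠ 0)
    (hx : x ^ m = 1) (hy : y ^ n = 1) {s t : ℤ} (hst : s + t = 1)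
    (hs : (m : ℤ) ∣ s) (ht : (n : ℤ) ∣ t) : (x * y) ^ t = x := by
  obtain ⟨c, rfl⟩ := hs
  obtain ⟨d, rfl⟩ := ht
  rw [mul_zpow, zpow_mul y, zpow_natCast, hy, one_zpow, mul_one,
    show (n : ℤ) * d = 1 - m * c by linarith, zpow_sub₀ hx0, zpow_mul, zpow_natCast, hx,
    one_zpow, zpow_one, div_one]

theorem pre_rgbpot_evaluation_factorization
    (F K : Type*) [Field F] [Fintype F] [Field K] [Algebra F K]
    (ℓ mA mB : ℕ) (hℓ : 0 < ℓ) (hmA : 0 < mA) (hmB : 0 < mB)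
    (hcop : Nat.Coprime mA mB)
    (a b : ℤ) (hab : a * (ℓ * mA) + b * mB = 1)
    (GA : Matrix (Fin ℓ) (Fin ℓ) F[X])
    (hGAtri : ∀ i j : Fin ℓ, j < i → GA i j = 0)
    (gB : F[X])
    (u v g rdiag : Fin ℓ → F[X])
    (hrdiag : ∀ h : Fin ℓ, qmk F (mA * mB) (rdiag h)
      = substX F (mA * mB) (b * mB) (GA h h) * substX F (mA * mB) (a * (ℓ * mA)) gB)
    (hbez : ∀ h : Fin ℓ, g h = u h * (X ^ (mA * mB) - 1) + v h * rdiag h)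
    (α β : K) (hα : orderOf α = mA) (hβ : orderOf β = mB)
    (Gbar : Matrix (Fin ℓ) (Fin ℓ) F[X])
    (hGbarDiag : ∀ h : Fin ℓ, qmk F (mA * mB) (Gbar h h) = qmk F (mA * mB) (g h))
    (hGbarLower : ∀ i j : Fin ℓ, j < i → qmk F (mA * mB) (Gbar i j) = 0)
    (hGbarUpper : ∀ i j : Fin ℓ, i < j → qmk F (mA * mB) (Gbar i j)
      = qmk F (mA * mB) (v i) *
          (substX F (mA * mB) (b * mB) (GA i j) * substX F (mA * mB) (a * (ℓ * mA)) gB)) :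
    ∀ z : ℤ,
      (Gbar.map fun q => Polynomial.aeval ((α * β) ^ z) q)
        = Polynomial.aeval (β ^ z) gB •
            (Matrix.diagonal (fun h => Polynomial.aeval ((α * β) ^ z) (v h)) *
              (GA.map fun q => Polynomial.aeval (α ^ z) q))
      ∧ ∀ w : Fin ℓ → K,
          (GA.map fun q => Polynomial.aeval (α ^ z) q).mulVec w = 0 →
            (Gbar.map fun q => Polynomial.aeval ((α * β) ^ z) q).mulVec w = 0 := by
  intro z
  have hm : 0 < mA * mB := Nat.mul_pos hmA hmB
  have hαm : α ^ mA = 1 := hα ▸ pow_orderOf_eq_one α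
  have hβm : β ^ mB = 1 := hβ ▸ pow_orderOf_eq_one β
  have hα0 : α ≠ 0 := by
    rintro rfl
    simp [hmA.ne'] at hαm
  have hβ0 : β ≠ 0 := by
    rintro rfl
    simp [hmB.ne'] at hβm
  have hγ : ((α * β) ^ z) ^ (mA * mB) = 1 := by
    rw [← zpow_natCast, zpow_comm, zpow_natCast, mul_pow, pow_mul, hαm, pow_mul', hβm]
    simp
  have hdA : (mA : ℤ) ∣ a * (ℓ * mA) := ⟨a * ℓ, by ring⟩
  have hdB : (mB : ℤ) ∣ b * mB := ⟨b, by ring⟩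
  have hγA : ((α * β) ^ z) ^ (b * mB : ℤ) = α ^ z := by
    rw [zpow_comm, mul_zpow_eq_left hα0 hαm hβm hab hdA hdB]
  have hγB : ((α * β) ^ z) ^ (a * (ℓ * mA) : ℤ) = β ^ z := by
    rw [zpow_comm, mul_comm α β,
      mul_zpow_eq_left hβ0 hβm hαm ((add_comm _ _).trans hab) hdB hdA]
  have hprod (f : F[X]) :
      evalQR hγ (substX F (mA * mB) (b * mB) f * substX F (mA * mB) (a * (ℓ * mA)) gB)
        = aeval (α ^ z) f * aeval (β ^ z) gB := by
    rw [map_mul, evalQR_substX hm, evalQR_substX hm, hγA, hγB]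
  have hentry (i j : Fin ℓ) : aeval ((α * β) ^ z) (Gbar i j)
      = aeval (β ^ z) gB * (aeval ((α * β) ^ z) (v i) * aeval (α ^ z) (GA i j)) := by
    rw [← evalQR_qmk hγ (Gbar i j)]
    rcases lt_trichotomy i j with h | rfl | h
    · rw [hGbarUpper i j h, map_mul, hprod, evalQR_qmk]
      ring
    · have hr := congrArg (evalQR hγ) (hrdiag i)
      rw [hprod, evalQR_qmk] at hr
      rw [hGbarDiag, evalQR_qmk, hbez]
      simp only [map_add, map_mul, map_sub, map_pow, aeval_X, map_one, hr, hγ]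
      ring
    · rw [hGbarLower i j h, hGAtri i j h]
      simp
  have hfac : (Gbar.map fun q => aeval ((α * β) ^ z) q)
      = aeval (β ^ z) gB •
          (Matrix.diagonal (fun h => aeval ((α * β) ^ z) (v h)) *
            (GA.map fun q => aeval (α ^ z) q)) := by
    ext i j
    simp [Matrix.diagonal_mul, hentry]
  refine ⟨hfac, fun w hw => ?_⟩
  rw [hfac, Matrix.smul_mulVec, ← Matrix.mulVec_mulVec, hw, Matrix.mulVec_zero, smul_zero]
end

section
/- Let q be a prime power, let mA, mB be coprime positive integers with gcd(mA·mB, q) = 1, set m = mA·mB, nA = 2·mA, nB = mB, and let a, b be integers with a·nA + b·nB = 1. Let g^A_{00}, g^A_{01}, g^A_{11}, a^A_{00}, a^A_{01}, a^A_{11} ∈ F_q[X] satisfy a^A_{00}·g^A_{00} = X^{mA}−1, a^A_{00}·g^A_{01} + a^A_{01}·g^A_{11} = 0, and a^A_{11}·g^A_{11} = X^{mA}−1, and let g^B ∈ F_q[X] divide X^{mB}−1. Define g_{00}(X) = gcd(X^m−1, g^A_{00}(X^{b·nB})·g^B(X^{a·nA})) and g_{11}(X) = gcd(X^m−1, g^A_{11}(X^{b·nB})·g^B(X^{a·nA}))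 (substitution convention). Then g_{11}(X) divides ((X^m−1)/g_{00}(X)) · P(X) in F_q[X], where P(X) is any polynomial representative of the residue g^A_{01}(X^{b·nB})·g^B(X^{a·nA}) in F_q[X]/(X^m−1). -/
open Polynomial

/-- A separable polynomial divides every polynomial vanishing at all of its roots in an algebraic
closure. -/
lemma dvd_of_separable_of_forall_aeval_eq_zero {F : Type*} [Field F] {g p : F[X]}
    (hg : g.Separable)
    (h : ∀ ω : AlgebraicClosure F, aeval ω g = 0 → aeval ω p = 0) : g ∣ p := by
  rcases eq_or_ne p 0 with rfl | hp
  · exact dvd_zero g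
  let K := AlgebraicClosure F
  have hpK : p.map (algebraMap F K) ≠ 0 := Polynomial.map_ne_zero hp
  rw [← Polynomial.map_dvd_map' (algebraMap F K)]
  refine (IsAlgClosed.splits _).dvd_of_roots_le_roots (Polynomial.map_ne_zero hg.ne_zero) ?_
  rw [Multiset.le_iff_subset (nodup_roots hg.map)]
  intro ω hω
  rw [mem_roots hpK, IsRoot.def, eval_map_algebraMap]
  apply h
  simpa [eval_map_algebraMap] using (mem_roots'.1 hω).2

lemma X_pow_sub_one_separable_of_coprime_card {F : Type*} [Field F] [Fintype F] {n : ℕ}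
    (hn : Nat.Coprime n (Fintype.card F)) : (X ^ n - 1 : F[X]).Separable := by
  refine (X_pow_sub_one_separable_iff).2 fun h0 => ?_
  obtain ⟨p, hp⟩ := CharP.exists F
  have hpp : p.Prime := (CharP.char_is_prime_or_zero F p).resolve_right
    (CharP.char_ne_zero_of_finite F p)
  have h1 : p ∣ n := (CharP.cast_eq_zero_iff F p n).1 h0
  have h2 : p ∣ Fintype.card F :=
    (CharP.cast_eq_zero_iff F p _).1 (FiniteField.cast_card_eq_zero F)
  exact hpp.one_lt.ne' (Nat.dvd_one.1 (hn ▸ Nat.dvd_gcd h1 h2))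

/-- At an `m`-th root of unity `ω`, a representative of `f(X^s) g(X^t)` takes the value
`f(ω^s) g(ω^t)`. -/
lemma aeval_of_qmk_eq_substX_mul {F K : Type*} [Field F] [Field K] [Algebra F K] {m : ℕ}
    {s t : ℤ} {r f g : F[X]} (hr : qmk F m r = substX F m s f * substX F m t g)
    {ω : K} (hω : ω ^ m = 1) :
    aeval ω r = aeval (ω ^ (s % (m : ℤ)).toNat) f * aeval (ω ^ (t % (m : ℤ)).toNat) g := by
  have hr' : qmk F m r = qmk F m (aeval (X ^ (s % (m : ℤ)).toNat) f *
      aeval (X ^ (t % (m : ℤ)).toNat) g) := by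
    rw [hr, map_mul]
    congr 1 <;>
      exact aeval_algHom_apply (AdjoinRoot.mkₐ (X ^ m - 1 : F[X])) _ _
  obtain ⟨c, hc⟩ := AdjoinRoot.mk_eq_mk.1 hr'
  have hc' := congrArg (aeval ω) hc
  simpa [hω, sub_eq_zero, ← aeval_algHom_apply] using hc'

theorem g11_divisibility
    (F : Type*) [Field F] [Fintype F]
    (mA mB : ℕ) (hmA : 0 < mA) (hmB : 0 < mB)
    (hcop : Nat.Coprime mA mB) (hchar : Nat.Coprime (mA * mB) (Fintype.card F))
    (a b : ℤ) (hab : a * (2 * mA) + b * mB = 1)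
    (gA00 gA01 gA11 aA00 aA01 aA11 : F[X])
    (h1 : aA00 * gA00 = X ^ mA - 1)
    (h2 : aA00 * gA01 + aA01 * gA11 = 0)
    (h3 : aA11 * gA11 = X ^ mA - 1)
    (gB : F[X]) (hgB : gB ∣ (X ^ mB - 1))
    (r00 r01 r11 : F[X])
    (hr00 : qmk F (mA * mB) r00
      = substX F (mA * mB) (b * mB) gA00 * substX F (mA * mB) (a * (2 * mA)) gB)
    (hr01 : qmk F (mA * mB) r01
      = substX F (mA * mB) (b * mB) gA01 * substX F (mA * mB) (a * (2 * mA)) gB)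
    (hr11 : qmk F (mA * mB) r11
      = substX F (mA * mB) (b * mB) gA11 * substX F (mA * mB) (a * (2 * mA)) gB)
    (g00 g11 : F[X])
    (hg00 : IsMonicGcd (X ^ (mA * mB) - 1) r00 g00)
    (hg11 : IsMonicGcd (X ^ (mA * mB) - 1) r11 g11) :
    g11 ∣ ((X ^ (mA * mB) - 1) / g00) * r01 := by
  have hsep := X_pow_sub_one_separable_of_coprime_card hchar
  have hsepA := X_pow_sub_one_separable_of_coprime_card hchar.coprime_mul_right
  obtain ⟨hg00monic, hg00m, hg00r, -⟩ := hg00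
  obtain ⟨-, hg11m, hg11r, -⟩ := hg11
  refine dvd_of_separable_of_forall_aeval_eq_zero (hsep.of_dvd hg11m) fun ω hω => ?_
  have hvanish {p : F[X]} (h : g11 ∣ p) : aeval ω p = 0 := by
    obtain ⟨c, rfl⟩ := h
    rw [map_mul, hω, zero_mul]
  have hωm : ω ^ (mA * mB) = 1 := by simpa [sub_eq_zero] using hvanish hg11m
  have e01 := aeval_of_qmk_eq_substX_mul hr01 hωm
  have e00 := aeval_of_qmk_eq_substX_mul hr00 hωm
  have e11 := aeval_of_qmk_eq_substX_mul hr11 hωm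
  set α := ω ^ (b * mB % ((mA * mB : ℕ) : ℤ)).toNat
  rw [map_mul, e01]
  by_cases h0 : aeval ω g00 = 0
  · by_cases hB : aeval (ω ^ (a * (2 * mA) % ((mA * mB : ℕ) : ℤ)).toNat) gB = 0
    · rw [hB, mul_zero, mul_zero]
    have hA00 : aeval α gA00 = 0 := by
      obtain ⟨c, rfl⟩ := hg00r
      rw [map_mul, h0, zero_mul] at e00
      exact (mul_eq_zero.1 e00.symm).resolve_right hB
    have hA11 : aeval α gA11 = 0 := by
      rw [hvanish hg11r] at e11
      exact (mul_eq_zero.1 e11.symm).resolve_right hB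
    have ha00 : aeval α aA00 ≠ 0 := by
      intro ha
      rw [← h1] at hsepA
      obtain ⟨u, v, huv⟩ := hsepA.isCoprime
      simpa [ha, hA00] using congrArg (aeval α) huv
    have h2α := congrArg (aeval α) h2
    rw [map_add, map_mul, map_mul, hA11, mul_zero, add_zero, map_zero] at h2α
    rw [(mul_eq_zero.1 h2α).resolve_left ha00, zero_mul, mul_zero]
  · have hq : aeval ω ((X ^ (mA * mB) - 1) / g00) * aeval ω g00 = 0 := by
      rw [← map_mul, mul_comm, EuclideanDomain.mul_div_cancel' hg00monic.ne_zero hg00m]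
      exact hvanish hg11m
    rw [(mul_eq_zero.1 hq).resolve_right h0, zero_mul]
end

section
/- Let F_q be a finite field of cardinality q, let m, r, t be positive integers with gcd(m, q) = 1, gcd(r, q) = 1, and m dividing r·t. Let f, g ∈ F_q[X] satisfy f·g = X^r − 1. Then gcd(f(X^t), X^m−1) · gcd(g(X^t), X^m−1) equals X^m−1 up to multiplication by a nonzero constant of F_q; equivalently, gcd(f(X^t), X^m−1) is an associate of (X^m−1)/gcd(g(X^t), X^m−1). -/
open Polynomial

/-- If `p * q` is divisible by `n` and `p`, `q` are coprime, then the monic gcds of `p` and `q`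
with `n` multiply to an associate of `n`. -/
theorem IsMonicGcd.associated_mul {F : Type*} [Field F] {p q n a b : F[X]}
    (ha : IsMonicGcd p n a) (hb : IsMonicGcd q n b) (hpq : IsCoprime p q) (hn : n ∣ p * q) :
    Associated (a * b) n := by
  obtain ⟨-, hap, han, hmaxa⟩ := ha
  obtain ⟨-, hbq, hbn, hmaxb⟩ := hb
  have hab : IsCoprime a b := hpq.mono hap hbq
  refine associated_of_dvd_dvd (hab.mul_dvd han hbn) ?_
  obtain ⟨c, d, hc, hd, rfl⟩ := exists_dvd_and_dvd_of_dvd_mul hn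
  exact mul_dvd_mul (hmaxa c hc (dvd_mul_right c d)) (hmaxb d hd (dvd_mul_left d c))

theorem FiniteField.natCast_ne_zero_of_coprime_card {F : Type*} [Field F] [Fintype F] {n : ℕ}
    (hn : n.Coprime (Fintype.card F)) : (n : F) ≠ 0 := by
  have h : IsCoprime (n : F) (Fintype.card F : F) := hn.cast
  rw [FiniteField.cast_card_eq_zero, isCoprime_zero_right] at h
  exact h.ne_zero

theorem gcd_substitution_complement
    (F : Type*) [Field F] [Fintype F]
    (m r t : ℕ) (hm : 0 < m) (hr : 0 < r) (ht : 0 < t)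
    (hmq : Nat.Coprime m (Fintype.card F)) (hrq : Nat.Coprime r (Fintype.card F))
    (hdvd : m ∣ r * t)
    (f g : F[X]) (hfg : f * g = X ^ r - 1)
    (gf gg : F[X])
    (hgf : IsMonicGcd (f.comp (X ^ t)) (X ^ m - 1) gf)
    (hgg : IsMonicGcd (g.comp (X ^ t)) (X ^ m - 1) gg) :
    Associated (gf * gg) (X ^ m - 1)
    ∧ Associated gf ((X ^ m - 1) / gg) := by
  have hcop : IsCoprime f g := by
    have hsep : (f * g).Separable := by
      rw [hfg, X_pow_sub_one_separable_iff]
      exact FiniteField.natCast_ne_zero_of_coprime_card hrq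
    exact hsep.isCoprime
  have hprod : f.comp (X ^ t) * g.comp (X ^ t) = X ^ (r * t) - 1 := by
    rw [← mul_comp, hfg]
    simp [← pow_mul, mul_comm t r]
  have hn : (X ^ m - 1 : F[X]) ∣ f.comp (X ^ t) * g.comp (X ^ t) := by
    obtain ⟨k, hk⟩ := hdvd
    rw [hprod, hk]
    exact pow_one_sub_dvd_pow_mul_sub_one X m k
  have hassoc : Associated (gf * gg) (X ^ m - 1) :=
    hgf.associated_mul hgg (hcop.map (compRingHom (X ^ t))) hn
  refine ⟨hassoc, ?_⟩
  have hgg0 : gg ≠ 0 := hgg.1.ne_zero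
  refine Associated.of_mul_right ?_ (Associated.refl gg) hgg0
  rwa [mul_comm ((X ^ m - 1) / gg), EuclideanDomain.mul_div_cancel' hgg0 hgg.2.2.1]
end

section
/- (Key equation.) Let F_{q^s} contain α of multiplicative order mA and β of multiplicative order mB. Let b(X) = Σ_{w ∈ W} b_w·X^w ∈ F_q[X] with support W ⊆ [0, mB), let e_0(X),…,e_{ℓ−1}(X) ∈ F_q[X] each have degree < mA, let 𝓔 ⊆ [0, mA) be the union of their supports with |𝓔| = ν, and let v = (v_0,…,v_{ℓ−1}) ∈ F_{q^s}^ℓ. Let integers f1, f2 ≥ 0, z1, z2 > 0, δ > 2. Define the syndrome polynomial S(X) = Σ_{i=0}^{δ−2} (Σ_{j=0}^{ℓ−1} e_j(α^{f1+i·z1})·b(β^{f2+i·z2})·v_j)·X^i ∈ F_{q^s}[X] and the error-locator polynomial Λ(X) = Π_{p ∈ 𝓔} Π_{w ∈ W} (1 − X·α^{z1·p}·β^{z2·w}) ∈ F_{q^s}[X]. Then there exists Ω(X) ∈ F_{q^s}[X] with deg Ω < |W|·ν such that Λ(X)·S(X) ≡ Ω(X) mod X^{δ−1}. -/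
open Polynomial

lemma degree_prod_one_sub_C_mul_X_le {K ι : Type*} [Field K] (s : Finset ι) (a : ι → K) :
    (∏ y ∈ s, (1 - C (a y) * X) : K[X]).degree ≤ (s.card : WithBot ℕ) := by
  refine (degree_prod_le s _).trans ?_
  calc ∑ y ∈ s, (1 - C (a y) * X : K[X]).degree ≤ ∑ _y ∈ s, (1 : WithBot ℕ) := by
        refine Finset.sum_le_sum fun y _ => ?_
        compute_degree
    _ = (s.card : WithBot ℕ) := by simp

/-- A sum of geometric series with ratios `a x * X`, truncated at degree `n`, is modulo `X ^ n`
a rational function with denominator `∏ x, (1 - a x * X)` and numerator of degree `< |s|`. -/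
lemma exists_degree_lt_card_and_X_pow_dvd_sub {K ι : Type*} [Field K] [DecidableEq ι]
    (s : Finset ι) (a c : ι → K) (n : ℕ) :
    ∃ Ω : K[X], Ω.degree < (s.card : WithBot ℕ) ∧
      (X ^ n : K[X]) ∣ (∏ x ∈ s, (1 - C (a x) * X)) *
        (∑ i ∈ Finset.range n, C (∑ x ∈ s, c x * a x ^ i) * X ^ i) - Ω := by
  refine ⟨∑ x ∈ s, C (c x) * ∏ y ∈ s.erase x, (1 - C (a y) * X), ?_, ?_⟩
  · refine (degree_sum_le s _).trans_lt <|
      (Finset.sup_lt_iff (WithBot.bot_lt_coe _)).2 fun x hx => ?_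
    refine ((degree_mul_le _ _).trans (add_le_of_nonpos_left degree_C_le)).trans_lt ?_
    refine (degree_prod_one_sub_C_mul_X_le _ a).trans_lt ?_
    exact Nat.cast_lt.2 (Finset.card_erase_lt_of_mem hx)
  · have hS : (∑ i ∈ Finset.range n, C (∑ x ∈ s, c x * a x ^ i) * X ^ i : K[X]) =
        ∑ x ∈ s, C (c x) * ∑ i ∈ Finset.range n, (C (a x) * X) ^ i := by
      simp only [map_sum, Finset.sum_mul, Finset.mul_sum]
      rw [Finset.sum_comm]
      simp only [map_mul, map_pow, mul_pow, mul_assoc]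
    rw [hS, Finset.mul_sum, ← Finset.sum_sub_distrib]
    refine Finset.dvd_sum fun x hx => ?_
    rw [← Finset.mul_prod_erase s _ hx]
    refine ⟨-(C (c x) * (∏ y ∈ s.erase x, (1 - C (a y) * X)) * C (a x) ^ n), ?_⟩
    have hgeom := mul_neg_geom_sum (C (a x) * X : K[X]) n
    linear_combination (C (c x) * ∏ y ∈ s.erase x, (1 - C (a y) * X)) * hgeom

theorem key_equation
    (F K : Type*) [Field F] [Fintype F] [Field K] [Algebra F K]
    (ℓ mA mB : ℕ) (hℓ : 0 < ℓ) (hmA : 0 < mA) (hmB : 0 < mB)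
    (α β : K) (hα : orderOf α = mA) (hβ : orderOf β = mB)
    (bpoly : F[X]) (hW : ∀ w ∈ bpoly.support, w < mB)
    (e : Fin ℓ → F[X]) (hdeg : ∀ j : Fin ℓ, (e j).degree < (mA : WithBot ℕ))
    (Eset : Finset ℕ) (hEset : Eset = Finset.univ.biUnion fun j : Fin ℓ => (e j).support)
    (ν : ℕ) (hν : ν = Eset.card)
    (v : Fin ℓ → K)
    (f1 f2 z1 z2 δ : ℕ) (hz1 : 0 < z1) (hz2 : 0 < z2) (hδ : 2 < δ) :
    ∃ Ω : Polynomial K,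
      Ω.degree < ((bpoly.support.card * ν : ℕ) : WithBot ℕ) ∧
      (X ^ (δ - 1) : Polynomial K) ∣
        ((∏ p ∈ Eset, ∏ w ∈ bpoly.support,
            (1 - Polynomial.C (α ^ (z1 * p) * β ^ (z2 * w)) * X)) *
          (∑ i ∈ Finset.range (δ - 1),
            Polynomial.C (∑ j, Polynomial.aeval (α ^ (f1 + i * z1)) (e j) *
                Polynomial.aeval (β ^ (f2 + i * z2)) bpoly * v j) * X ^ i) - Ω) := by
  obtain ⟨Ω, hΩ, hdvd⟩ := exists_degree_lt_card_and_X_pow_dvd_sub (Eset ×ˢ bpoly.support)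
    (fun x => α ^ (z1 * x.1) * β ^ (z2 * x.2))
    (fun x => ∑ j, algebraMap F K ((e j).coeff x.1) * α ^ (f1 * x.1) *
      (algebraMap F K (bpoly.coeff x.2) * β ^ (f2 * x.2)) * v j) (δ - 1)
  refine ⟨Ω, ?_, ?_⟩
  · rwa [Finset.card_product, mul_comm, ← hν] at hΩ
  · rw [Finset.prod_product] at hdvd
    convert hdvd using 6 with i
    have he (j : Fin ℓ) (y : K) :
        aeval y (e j) = ∑ p ∈ Eset, algebraMap F K ((e j).coeff p) * y ^ p := by
      rw [aeval_def, eval₂_eq_sum]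
      refine sum_eq_of_subset _ (by simp) (hEset ▸ Finset.subset_biUnion_of_mem
        (fun j => (e j).support) (Finset.mem_univ j))
    have hb (y : K) : aeval y bpoly =
        ∑ w ∈ bpoly.support, algebraMap F K (bpoly.coeff w) * y ^ w := by
      rw [aeval_def, eval₂_eq_sum, sum_def]
    rw [Finset.sum_product]
    simp only [he, hb, Finset.sum_mul_sum]
    simp only [Finset.sum_mul]
    refine Finset.sum_comm.trans (Finset.sum_congr rfl fun p _ => ?_)
    refine Finset.sum_comm.trans (Finset.sum_congr rfl fun w _ => ?_)
    refine Finset.sum_congr rfl fun j _ => ?_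
    ring
end
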